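/- Let n ∈ {2,3,4}, let Ω ⊆ ℝⁿ be a bounded smooth domain, and let ε, c₃, c₄ > 0 and M ≥ 0. Then there exists a constant C > 0, depending only on Ω, ε, c₃, c₄, M, such that for every C∞ function f : ℝ → ℝ with sup_{s ∈ [0,c₄]} |f(s)| ≤ M, and every classical semi-stable solution u of −Δu = f(u) in Ω with u = 0 on ∂Ω which satisfies u(x) ≥ c₃ · dist(x,∂Ω) for all x ∈ Ω and sup_{x ∈ Ω_ε} u(x) ≤ c₄ where Ω_ε = {x ∈ Ω : dist(x,∂Ω) < ε}, one has sup_{x ∈ Ω} u(x) ≤ C. -/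

import Mathlib

open MeasureTheory Filter

noncomputable section

/-- The Euclidean Laplacian: trace of the Hessian. -/
def lapl {n : ℕ} (u : EuclideanSpace ℝ (Fin n) → ℝ) (x : EuclideanSpace ℝ (Fin n)) : ℝ :=
  ∑ i : Fin n, fderiv ℝ (fun y => fderiv ℝ u y (EuclideanSpace.single i 1)) x
    (EuclideanSpace.single i 1)

/-- Entries of the Hessian matrix. -/
def hess {n : ℕ} (u : EuclideanSpace ℝ (Fin n) → ℝ) (x : EuclideanSpace ℝ (Fin n))
    (i j : Fin n) : ℝ :=
  fderiv ℝ (fun y => fderiv ℝ u y (EuclideanSpace.single j 1)) x (EuclideanSpace.single i 1)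

/-- A bounded smooth domain of ℝⁿ. -/
def IsSmoothBoundedDomain {n : ℕ} (Ω : Set (EuclideanSpace ℝ (Fin n))) : Prop :=
  IsOpen Ω ∧ Bornology.IsBounded Ω ∧ Ω.Nonempty ∧
  ∃ ρ : EuclideanSpace ℝ (Fin n) → ℝ, ContDiff ℝ (⊤ : ℕ∞) ρ ∧
    Ω = {x | ρ x < 0} ∧ frontier Ω = {x | ρ x = 0} ∧
    ∀ x ∈ frontier Ω, gradient ρ x ≠ 0

/-- Classical solution of −Δu = f(u) in Ω, u = 0 on ∂Ω. -/
def IsClassicalSol {n : ℕ} (Ω : Set (EuclideanSpace ℝ (Fin n))) (f : ℝ → ℝ)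
    (u : EuclideanSpace ℝ (Fin n) → ℝ) : Prop :=
  (∃ U, IsOpen U ∧ closure Ω ⊆ U ∧ ContDiffOn ℝ 2 u U) ∧
  (∀ x ∈ Ω, lapl u x + f (u x) = 0) ∧
  (∀ x ∈ frontier Ω, u x = 0)

/-- Semi-stability of a solution u. -/
def IsSemiStable {n : ℕ} (Ω : Set (EuclideanSpace ℝ (Fin n))) (f : ℝ → ℝ)
    (u : EuclideanSpace ℝ (Fin n) → ℝ) : Prop :=
  ∀ ξ : EuclideanSpace ℝ (Fin n) → ℝ, (∃ K : NNReal, LipschitzWith K ξ) →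
    (∀ x ∈ frontier Ω, ξ x = 0) →
    0 ≤ ∫ x in Ω, (‖gradient ξ x‖ ^ 2 - deriv f (u x) * ξ x ^ 2)

/-- Weak solution of −Δu = f(u) in Ω, u = 0 on ∂Ω. -/
def IsWeakSol {n : ℕ} (Ω : Set (EuclideanSpace ℝ (Fin n))) (f : ℝ → ℝ)
    (u : EuclideanSpace ℝ (Fin n) → ℝ) : Prop :=
  IntegrableOn u Ω volume ∧
  IntegrableOn (fun x => f (u x) * Metric.infDist x (frontier Ω)) Ω volume ∧
  ∀ ξ : EuclideanSpace ℝ (Fin n) → ℝ,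
    (∃ U, IsOpen U ∧ closure Ω ⊆ U ∧ ContDiffOn ℝ 2 ξ U) →
    (∀ x ∈ frontier Ω, ξ x = 0) →
    ∫ x in Ω, (u x * lapl ξ x + f (u x) * ξ x) = 0

/-- The `i`-th partial derivative. -/
def pd {n : ℕ} (i : Fin n) (g : EuclideanSpace ℝ (Fin n) → ℝ) (x : EuclideanSpace ℝ (Fin n)) : ℝ :=
  fderiv ℝ g x (EuclideanSpace.single i 1)

section PartialDerivatives

variable {n : ℕ} {i j : Fin n} {g h : EuclideanSpace ℝ (Fin n) → ℝ} {x : EuclideanSpace ℝ (Fin n)}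

lemma pd_add (hg : DifferentiableAt ℝ g x) (hh : DifferentiableAt ℝ h x) :
    pd i (fun y => g y + h y) x = pd i g x + pd i h x := by
  simp [pd, fderiv_fun_add hg hh]

lemma pd_sub (hg : DifferentiableAt ℝ g x) (hh : DifferentiableAt ℝ h x) :
    pd i (fun y => g y - h y) x = pd i g x - pd i h x := by
  simp [pd, fderiv_fun_sub hg hh]

lemma pd_mul (hg : DifferentiableAt ℝ g x) (hh : DifferentiableAt ℝ h x) :
    pd i (fun y => g y * h y) x = pd i g x * h x + g x * pd i h x := by
  simp [pd, fderiv_fun_mul hg hh]; ring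

lemma pd_sum {ι : Type*} {s : Finset ι} {G : ι → EuclideanSpace ℝ (Fin n) → ℝ}
    (hG : ∀ k ∈ s, DifferentiableAt ℝ (G k) x) :
    pd i (fun y => ∑ k ∈ s, G k y) x = ∑ k ∈ s, pd i (G k) x := by
  simp [pd, fderiv_fun_sum hG]

lemma pd_comp {φ : ℝ → ℝ} {φ' : ℝ} (hφ : HasDerivAt φ φ' (g x)) (hg : DifferentiableAt ℝ g x) :
    pd i (fun y => φ (g y)) x = φ' * pd i g x := by
  have := (hφ.comp_hasFDerivAt x hg.hasFDerivAt).fderiv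
  simp only [pd]
  rw [show (fun y => φ (g y)) = φ ∘ g from rfl, this]
  simp

lemma pd_sq (hg : DifferentiableAt ℝ g x) :
    pd i (fun y => g y ^ 2) x = 2 * g x * pd i g x := by
  simp only [sq]
  rw [pd_mul hg hg]; ring

lemma pd_congr_of_eventuallyEq (hgh : g =ᶠ[nhds x] h) : pd i g x = pd i h x := by
  simp only [pd, hgh.fderiv_eq]

lemma ContDiff.pd {k m : WithTop ℕ∞} (hg : ContDiff ℝ m g) (hk : k + 1 ≤ m) :
    ContDiff ℝ k (pd i g) :=
  (hg.fderiv_right hk).clm_apply contDiff_const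

lemma ContDiff.pd_one (hg : ContDiff ℝ 2 g) : ContDiff ℝ 1 (_root_.pd i g) :=
  hg.pd (by norm_num [one_add_one_eq_two])

lemma ContDiff.continuous_pd (hg : ContDiff ℝ 1 g) : Continuous (_root_.pd i g) :=
  (hg.pd (k := 0) (by simp)).continuous

lemma HasCompactSupport.pd (hg : HasCompactSupport g) : HasCompactSupport (_root_.pd i g) :=
  hg.fderiv_apply (𝕜 := ℝ) _

lemma pd_eq_zero_of_notMem_tsupport (hx : x ∉ tsupport g) : pd i g x = 0 := by
  have : fderiv ℝ g x = 0 := by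
    by_contra h
    exact hx (support_fderiv_subset ℝ h)
  simp [pd, this]

lemma pd_comm (hg : ContDiff ℝ 2 g) : pd i (pd j g) x = pd j (pd i g) x := by
  have h2 : IsSymmSndFDerivAt ℝ g x := hg.contDiffAt.isSymmSndFDerivAt (by simp)
  have hd : DifferentiableAt ℝ (fderiv ℝ g) x :=
    ((hg.fderiv_right (m := 1) (by norm_num [one_add_one_eq_two])).differentiable
      (by norm_num)).differentiableAt
  have key : ∀ a b : Fin n, pd a (pd b g) x = fderiv ℝ (fderiv ℝ g) x
      (EuclideanSpace.single a 1) (EuclideanSpace.single b 1) := by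
    intro a b
    have : pd b g = fun y => fderiv ℝ g y (EuclideanSpace.single b 1) := rfl
    rw [this, pd, fderiv_clm_apply hd (by fun_prop)]
    simp
  rw [key, key, h2.eq]

lemma integral_pd_eq_zero (hg : ContDiff ℝ 1 g) (hc : HasCompactSupport g) :
    ∫ x, pd i g x = 0 := by
  have hd : Differentiable ℝ g := hg.differentiable (by norm_num)
  have := integral_mul_fderiv_eq_neg_fderiv_mul_of_integrable (μ := volume)
    (f := fun _ : EuclideanSpace ℝ (Fin n) => (1 : ℝ)) (g := g)
    (v := EuclideanSpace.single i 1) (by simp)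
    (by simp only [one_mul]
        exact (hg.continuous_pd (i := i)).integrable_of_hasCompactSupport hc.pd)
    (by simp only [one_mul]; exact hg.continuous.integrable_of_hasCompactSupport hc)
    (by intro x _; fun_prop) (fun x _ => hd x)
  simpa [pd] using this

lemma integral_pd_mul (hg : ContDiff ℝ 1 g) (hh : ContDiff ℝ 1 h) (hc : HasCompactSupport h) :
    ∫ x, pd i g x * h x = - ∫ x, g x * pd i h x := by
  have hdg : Differentiable ℝ g := hg.differentiable (by norm_num)
  have hdh : Differentiable ℝ h := hh.differentiable (by norm_num)
  have := integral_pd_eq_zero (i := i) (hg.mul hh) (hc.mul_left)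
  have e : (fun x => pd i (fun x => g x * h x) x) = fun x => pd i g x * h x + g x * pd i h x := by
    ext x; exact pd_mul (hdg x) (hdh x)
  rw [e, integral_add] at this
  · linarith
  · exact ((hg.continuous_pd).mul hh.continuous).integrable_of_hasCompactSupport hc.mul_left
  · exact (hg.continuous.mul hh.continuous_pd).integrable_of_hasCompactSupport hc.pd.mul_left

lemma hasDerivAt_comp_add_smul (hg : Differentiable ℝ g) (t : ℝ) :
    HasDerivAt (fun t : ℝ => g (x + t • EuclideanSpace.single i 1))
      (pd i g (x + t • EuclideanSpace.single i 1)) t := by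
  have h1 : HasDerivAt (fun t : ℝ => x + t • EuclideanSpace.single i (1:ℝ))
      (EuclideanSpace.single i 1) t := by
    simpa using ((hasDerivAt_id t).smul_const (EuclideanSpace.single i (1:ℝ))).const_add x
  exact (hg _).hasFDerivAt.comp_hasDerivAt t h1

/-- Differentiating a translate under the integral sign. -/
lemma hasDerivAt_integral_translate_mul (hg : ContDiff ℝ 1 g) (hgc : HasCompactSupport g)
    (hh : Continuous h) (hhc : HasCompactSupport h) :
    HasDerivAt (fun t : ℝ => ∫ x, g (x + t • EuclideanSpace.single i 1) * h x)
      (∫ x, pd i g x * h x) 0 := by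
  obtain ⟨C, hC⟩ := (hg.continuous_pd (i := i)).bounded_above_of_compact_support hgc.pd
  have hi := hh.integrable_of_hasCompactSupport (μ := volume) hhc
  have := (hasDerivAt_integral_of_dominated_loc_of_deriv_le (μ := volume) (𝕜 := ℝ) (x₀ := 0)
    (s := Set.univ)
    (F := fun t x => g (x + t • EuclideanSpace.single i 1) * h x)
    (F' := fun t x => pd i g (x + t • EuclideanSpace.single i 1) * h x)
    (bound := fun x => C * ‖h x‖) Filter.univ_mem ?_ ?_ ?_ ?_ (hi.norm.const_mul C) ?_).2
  · simpa using this
  · refine Filter.Eventually.of_forall fun t => Continuous.aestronglyMeasurable ?_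
    exact (hg.continuous.comp (by fun_prop)).mul hh
  · simp only [zero_smul, add_zero]
    exact (hg.continuous.mul hh).integrable_of_hasCompactSupport hhc.mul_left
  · simp only [zero_smul, add_zero]
    exact ((hg.continuous_pd (i := i)).mul hh).aestronglyMeasurable
  · refine Filter.Eventually.of_forall fun x t _ => ?_
    rw [norm_mul]
    exact mul_le_mul_of_nonneg_right (hC _) (norm_nonneg _)
  · refine Filter.Eventually.of_forall fun x t _ => ?_
    exact (hasDerivAt_comp_add_smul (hg.differentiable (by norm_num)) t).mul_const _

/-- For compactly supported `C¹` functions the mixed Dirichlet form is symmetric in the two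
directions. -/
lemma integral_pd_mul_pd_comm (hg : ContDiff ℝ 1 g) (hgc : HasCompactSupport g)
    (hh : ContDiff ℝ 1 h) (hhc : HasCompactSupport h) :
    ∫ x, pd i g x * pd j h x = ∫ x, pd j g x * pd i h x := by
  have h1 := hasDerivAt_integral_translate_mul (i := i) hg hgc
    (hh.continuous_pd (i := j)) hhc.pd
  have h2 := hasDerivAt_integral_translate_mul (i := i) hh hhc
    (hg.continuous_pd (i := j)) hgc.pd
  have h3 : HasDerivAt (fun t : ℝ => - ∫ x, h (x + (-t) • EuclideanSpace.single i 1) * pd j g x)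
      (∫ x, pd i h x * pd j g x) 0 := by
    have h2' : HasDerivAt (fun t : ℝ => ∫ x, h (x + t • EuclideanSpace.single i 1) * pd j g x)
      (∫ x, pd i h x * pd j g x) (-0) := by simpa using h2
    have := (h2'.scomp (0:ℝ) (hasDerivAt_neg (0:ℝ))).neg
    simp only [neg_smul, one_smul, neg_neg] at this
    exact this
  have e : (fun t : ℝ => ∫ x, g (x + t • EuclideanSpace.single i 1) * pd j h x) =
      fun t : ℝ => - ∫ x, h (x + (-t) • EuclideanSpace.single i 1) * pd j g x := by
    ext t
    set w : EuclideanSpace ℝ (Fin n) := t • EuclideanSpace.single i 1 with hw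
    have ht : ContDiff ℝ 1 (fun x => g (x + w)) := hg.comp (by fun_prop)
    have hpd : ∀ x, pd j (fun x => g (x + w)) x = pd j g (x + w) := by
      intro x
      simp only [pd]
      rw [fderiv_comp_add_right]
    have := integral_pd_mul (i := j) ht hh hhc
    simp only [hpd] at this
    have h4 : ∫ x, pd j g (x + w) * h x = ∫ x, pd j g x * h (x - w) := by
      rw [← integral_add_right_eq_self (fun x => pd j g x * h (x - w)) w]
      simp
    rw [neg_smul, ← hw]
    simp only [← sub_eq_add_neg]
    have h5 : ∫ x, h (x - w) * pd j g x = ∫ x, pd j g x * h (x - w) := by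
      congr 1; ext x; ring
    linarith
  rw [e] at h1
  rw [h1.unique h3]
  congr 1; ext x; ring

end PartialDerivatives

section GeometricStability

variable {n : ℕ}

lemma integrable_of_eq_zero_off_tsupport {F η : EuclideanSpace ℝ (Fin n) → ℝ}
    (hF : Continuous F) (hη : HasCompactSupport η) (h0 : ∀ x ∉ tsupport η, F x = 0) :
    Integrable F :=
  hF.integrable_of_hasCompactSupport (HasCompactSupport.intro hη h0)

/-- The weak form of the equation satisfied by the partial derivatives of a solution. -/
lemma integral_linearized {O : Set (EuclideanSpace ℝ (Fin n))} {f : ℝ → ℝ}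
    {u ψ : EuclideanSpace ℝ (Fin n) → ℝ} (i : Fin n)
    (hu : ContDiff ℝ 2 u) (huc : HasCompactSupport u) (hf : ContDiff ℝ 1 f)
    (heq : ∀ x ∈ O, ∑ j, pd j (pd j u) x + f (u x) = 0)
    (hψ : ContDiff ℝ 1 ψ) (hψc : HasCompactSupport ψ) (hψO : tsupport ψ ⊆ O) :
    ∫ x, ∑ j, pd j (pd i u) x * pd j ψ x = ∫ x, deriv f (u x) * pd i u x * ψ x := by
  have hg : ∀ k, ContDiff ℝ 1 (pd k u) := fun k => hu.pd_one
  have hint : ∀ k l m : Fin n, Integrable (fun x => pd k (pd l u) x * pd m ψ x) := fun k l m =>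
    (((hg l).continuous_pd (i := k)).mul (hψ.continuous_pd (i := m))).integrable_of_hasCompactSupport
      hψc.pd.mul_left
  have hfu : ContDiff ℝ 1 (fun x => f (u x)) := hf.comp (hu.of_le (by norm_num))
  have h1 := integral_pd_mul (i := i) hfu hψ hψc
  have h2 : ∀ x, pd i (fun x => f (u x)) x = deriv f (u x) * pd i u x := fun x =>
    pd_comp (hf.differentiable (by norm_num) _).hasDerivAt (hu.differentiable (by norm_num) x)
  simp only [h2] at h1
  rw [h1, integral_finsetSum _ (fun j _ => hint j i j)]
  have h3 : ∀ j, ∫ x, pd j (pd i u) x * pd j ψ x = ∫ x, pd j (pd j u) x * pd i ψ x := by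
    intro j
    simp_rw [fun x => pd_comm (i := j) (j := i) (x := x) hu]
    exact integral_pd_mul_pd_comm (hg j) huc.pd hψ hψc
  simp_rw [h3]
  rw [← integral_finsetSum _ (fun j _ => hint j j i), ← integral_neg]
  congr 1
  ext x
  by_cases hx : x ∈ tsupport ψ
  · rw [← Finset.sum_mul, show ∑ j, pd j (pd j u) x = - f (u x) by linarith [heq x (hψO hx)]]
    ring
  · simp [pd_eq_zero_of_notMem_tsupport hx]

/-- The (regularised) geometric form of the stability inequality of Sternberg and Zumbrun. -/
lemma geometric_stability {O : Set (EuclideanSpace ℝ (Fin n))} {f : ℝ → ℝ}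
    {u η : EuclideanSpace ℝ (Fin n) → ℝ}
    (hu : ContDiff ℝ 2 u) (huc : HasCompactSupport u) (hf : ContDiff ℝ 1 f)
    (heq : ∀ x ∈ O, ∑ j, pd j (pd j u) x + f (u x) = 0)
    (hstab : ∀ ξ : EuclideanSpace ℝ (Fin n) → ℝ, ContDiff ℝ 1 ξ → HasCompactSupport ξ →
      tsupport ξ ⊆ O → ∫ x, deriv f (u x) * ξ x ^ 2 ≤ ∫ x, ∑ i, pd i ξ x ^ 2)
    (hη : ContDiff ℝ 1 η) (hηc : HasCompactSupport η) (hηO : tsupport η ⊆ O)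
    {δ : ℝ} (hδ : 0 < δ) :
    ∫ x, (∑ i, ∑ j, pd i (pd j u) x ^ 2 - (∑ i, (∑ j, pd i (pd j u) x * pd j u x) ^ 2) /
        (∑ j, pd j u x ^ 2 + δ)) * η x ^ 2 ≤
      ∫ x, (∑ j, pd j u x ^ 2) * ∑ i, pd i η x ^ 2 +
        δ * (∑ i, pd i η x ^ 2 + |deriv f (u x)| * η x ^ 2) := by
  have hg : ∀ k, ContDiff ℝ 1 (pd k u) := fun k => hu.pd_one
  have hgc : ∀ k, Continuous (pd k u) := fun k => (hg k).continuous
  have hBc : ∀ k l, Continuous (pd k (pd l u)) := fun k l => (hg l).continuous_pd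
  have hgd : ∀ k, Differentiable ℝ (pd k u) := fun k => (hg k).differentiable (by norm_num)
  have hηd : Differentiable ℝ η := hη.differentiable (by norm_num)
  have hηcont : Continuous η := hη.continuous
  have hpη : ∀ k, Continuous (pd k η) := fun k => hη.continuous_pd
  have hf'c : Continuous (fun x => deriv f (u x)) :=
    (hf.continuous_deriv (by norm_num)).comp hu.continuous
  have hη0 : ∀ x ∉ tsupport η, η x = 0 := fun x hx => image_eq_zero_of_notMem_tsupport hx
  have hpη0 : ∀ i, ∀ x ∉ tsupport η, pd i η x = 0 := fun i x hx =>
    pd_eq_zero_of_notMem_tsupport hx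
  set S : EuclideanSpace ℝ (Fin n) → ℝ := fun x => ∑ j, pd j u x ^ 2 with hS
  have hS0 : ∀ x, 0 ≤ S x := fun x => Finset.sum_nonneg fun j _ => sq_nonneg _
  have hSC : ContDiff ℝ 1 S := ContDiff.sum fun j _ => (hg j).pow 2
  have hScont : Continuous S := hSC.continuous
  set w : EuclideanSpace ℝ (Fin n) → ℝ := fun x => Real.sqrt (S x + δ) with hw
  have hpos : ∀ x, 0 < S x + δ := fun x => by linarith [hS0 x]
  have hwpos : ∀ x, 0 < w x := fun x => Real.sqrt_pos.2 (hpos x)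
  have hwsq : ∀ x, w x ^ 2 = S x + δ := fun x => Real.sq_sqrt (hpos x).le
  have hwC : ContDiff ℝ 1 w := (hSC.add contDiff_const).sqrt fun x => (hpos x).ne'
  have hwd : Differentiable ℝ w := hwC.differentiable (by norm_num)
  -- the derivative of the regularised modulus of the gradient
  have hwpd : ∀ i x, w x * pd i w x = ∑ j, pd i (pd j u) x * pd j u x := by
    intro i x
    have h1 : pd i (fun y => w y ^ 2) x = 2 * w x * pd i w x := pd_sq (hwd x)
    have h2 : pd i (fun y => w y ^ 2) x = ∑ j, 2 * pd j u x * pd i (pd j u) x := by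
      simp only [hwsq]
      rw [pd_add (hSC.differentiable (by norm_num) x) (by fun_prop)]
      have hgd2 : ∀ j, DifferentiableAt ℝ (fun y => pd j u y ^ 2) x := fun j => (hgd j x).pow 2
      rw [hS, pd_sum (fun j _ => hgd2 j)]
      simp_rw [pd_sq (hgd _ x)]
      simp [pd]
    have h3 : 2 * ∑ j, pd i (pd j u) x * pd j u x = ∑ j, 2 * pd j u x * pd i (pd j u) x := by
      rw [Finset.mul_sum]; exact Finset.sum_congr rfl fun j _ => by ring
    linarith
  set BG : Fin n → EuclideanSpace ℝ (Fin n) → ℝ :=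
    fun i x => ∑ j, pd i (pd j u) x * pd j u x with hBG
  have hBGc : ∀ i, Continuous (BG i) := fun i => by
    simp only [hBG]; fun_prop
  -- stability tested with `w * η`
  have hξ := hstab (fun x => w x * η x) (hwC.mul hη) hηc.mul_left
    ((tsupport_mul_subset_right).trans hηO)
  have e2 : ∀ x, ∑ i, pd i (fun x => w x * η x) x ^ 2 =
      (∑ i, BG i x ^ 2) / (S x + δ) * η x ^ 2 + 2 * η x * ∑ i, BG i x * pd i η x +
        (S x + δ) * ∑ i, pd i η x ^ 2 := by
    intro x
    rw [Finset.sum_div, Finset.sum_mul, Finset.mul_sum, Finset.mul_sum, ← Finset.sum_add_distrib,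
      ← Finset.sum_add_distrib]
    refine Finset.sum_congr rfl fun i _ => ?_
    rw [pd_mul (hwd x) (hηd x), ← hwsq, show BG i x = w x * pd i w x from (hwpd i x).symm]
    have := (hwpos x).ne'
    field_simp
    ring
  simp_rw [e2, mul_pow, hwsq] at hξ
  -- the linearised equation tested with `pd k u * η ^ 2`
  have hlin : ∫ x, (∑ i, ∑ j, pd i (pd j u) x ^ 2) * η x ^ 2 + 2 * η x * ∑ i, BG i x * pd i η x =
      ∫ x, deriv f (u x) * S x * η x ^ 2 := by
    have hk : ∀ k, ∫ x, ∑ j, pd j (pd k u) x * pd j (fun x => pd k u x * η x ^ 2) x =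
        ∫ x, deriv f (u x) * pd k u x * (pd k u x * η x ^ 2) := fun k =>
      integral_linearized k hu huc hf heq ((hg k).mul (hη.pow 2))
        (HasCompactSupport.intro hηc fun x hx => by simp [hη0 x hx])
        (((tsupport_mul_subset_right).trans (by
          simp only [sq]; exact tsupport_mul_subset_right)).trans hηO)
    have e3 : ∀ k j x, pd j (fun x => pd k u x * η x ^ 2) x =
        pd j (pd k u) x * η x ^ 2 + pd k u x * (2 * η x * pd j η x) := by
      intro k j x
      have hη2 : DifferentiableAt ℝ (fun y => η y ^ 2) x := (hηd x).pow 2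
      rw [pd_mul (hgd k x) hη2, pd_sq (hηd x)]
    simp_rw [e3] at hk
    have hs := Finset.sum_congr (rfl : (Finset.univ : Finset (Fin n)) = Finset.univ)
      fun k _ => hk k
    rw [← integral_finsetSum, ← integral_finsetSum] at hs
    · convert hs using 2
      · ext x
        simp only [hBG, Finset.sum_mul, Finset.mul_sum]
        rw [← Finset.sum_add_distrib, Finset.sum_comm' (t' := Finset.univ) (s' := fun _ => Finset.univ) (by simp)]
        refine Finset.sum_congr rfl fun i _ => ?_
        rw [← Finset.sum_add_distrib]
        refine Finset.sum_congr rfl fun j _ => ?_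
        ring
      · ext x
        simp only [hS, Finset.mul_sum, Finset.sum_mul]
        refine Finset.sum_congr rfl fun j _ => ?_
        ring
    · intro k _
      refine integrable_of_eq_zero_off_tsupport (by fun_prop) hηc fun x hx => ?_
      simp [hη0 x hx]
    · intro k _
      refine integrable_of_eq_zero_off_tsupport (by fun_prop) hηc fun x hx => ?_
      simp [hη0 x hx]
  have hdiv : Continuous fun x => (∑ i, BG i x ^ 2) / (S x + δ) :=
    (by fun_prop : Continuous fun x => ∑ i, BG i x ^ 2).div (by fun_prop) fun x => (hpos x).ne'
  have i1 : Integrable fun x => (∑ i, ∑ j, pd i (pd j u) x ^ 2) * η x ^ 2 +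
      2 * η x * ∑ i, BG i x * pd i η x :=
    integrable_of_eq_zero_off_tsupport (by fun_prop) hηc fun x hx => by simp [hη0 x hx]
  have i2 : Integrable fun x => (∑ i, BG i x ^ 2) / (S x + δ) * η x ^ 2 +
      2 * η x * ∑ i, BG i x * pd i η x + (S x + δ) * ∑ i, pd i η x ^ 2 :=
    integrable_of_eq_zero_off_tsupport (by fun_prop) hηc fun x hx => by
      simp [hη0 x hx, hpη0 _ x hx]
  have i3 : Integrable fun x => deriv f (u x) * S x * η x ^ 2 :=
    integrable_of_eq_zero_off_tsupport (by fun_prop) hηc fun x hx => by simp [hη0 x hx]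
  have i4 : Integrable fun x => deriv f (u x) * ((S x + δ) * η x ^ 2) :=
    integrable_of_eq_zero_off_tsupport (by fun_prop) hηc fun x hx => by simp [hη0 x hx]
  have i5 : Integrable fun x => (∑ i, ∑ j, pd i (pd j u) x ^ 2 - (∑ i, BG i x ^ 2) /
        (S x + δ)) * η x ^ 2 :=
    integrable_of_eq_zero_off_tsupport (by fun_prop) hηc fun x hx => by simp [hη0 x hx]
  have i6 : Integrable fun x => S x * ∑ i, pd i η x ^ 2 +
        δ * (∑ i, pd i η x ^ 2 + |deriv f (u x)| * η x ^ 2) :=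
    integrable_of_eq_zero_off_tsupport (by fun_prop) hηc fun x hx => by
      simp [hη0 x hx, hpη0 _ x hx]
  have hmono := integral_mono (i5.sub i6) ((i1.sub i3).sub (i2.sub i4)) (fun x => by
    simp only [Pi.sub_apply]
    have : 0 ≤ δ * η x ^ 2 * (|deriv f (u x)| + deriv f (u x)) :=
      mul_nonneg (by positivity) (by linarith [neg_abs_le (deriv f (u x))])
    nlinarith)
  rw [integral_sub' i5 i6, integral_sub' (i1.sub i3) (i2.sub i4), integral_sub' i1 i3,
    integral_sub' i2 i4] at hmono
  linarith

end GeometricStability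

section PointwiseInequalities

variable {n : ℕ}

lemma sum_sum_mul_sub_mul_sq (a v : Fin n → ℝ) :
    ∑ j, ∑ k, (a j * v k - a k * v j) ^ 2 =
      2 * ((∑ k, v k ^ 2) * ∑ j, a j ^ 2 - (∑ j, a j * v j) ^ 2) := by
  have h : ∀ j k, (a j * v k - a k * v j) ^ 2 =
      a j ^ 2 * v k ^ 2 + v j ^ 2 * a k ^ 2 - 2 * ((a j * v j) * (a k * v k)) := fun j k => by ring
  simp_rw [h, Finset.sum_sub_distrib, Finset.sum_add_distrib, ← Finset.mul_sum, ← Finset.sum_mul]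
  ring

/-- The vector `(tr B) v - B v` is controlled by the part of `B` seen by the geometric stability
inequality. -/
lemma sum_trace_mul_sub_sq_le {B : Fin n → Fin n → ℝ} (hB : ∀ i j, B i j = B j i)
    (v : Fin n → ℝ) :
    ∑ k, ((∑ j, B j j) * v k - ∑ j, B k j * v j) ^ 2 ≤
      2 * n * ((∑ k, v k ^ 2) * ∑ i, ∑ j, B i j ^ 2 - ∑ i, (∑ j, B i j * v j) ^ 2) := by
  have h1 : ∀ k, ((∑ j, B j j) * v k - ∑ j, B k j * v j) ^ 2 ≤
      n * ∑ j, (B j j * v k - B j k * v j) ^ 2 := by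
    intro k
    rw [Finset.sum_mul, ← Finset.sum_sub_distrib]
    simp_rw [fun j => hB k j]
    simpa using sq_sum_le_card_mul_sum_sq (s := Finset.univ)
      (f := fun j => B j j * v k - B j k * v j)
  have h2 : ∑ k, ∑ j, (B j j * v k - B j k * v j) ^ 2 ≤
      ∑ i, ∑ j, ∑ k, (B i j * v k - B i k * v j) ^ 2 := by
    rw [Finset.sum_comm]
    refine Finset.sum_le_sum fun i _ => ?_
    exact Finset.single_le_sum (f := fun j => ∑ k, (B i j * v k - B i k * v j) ^ 2)
      (fun j _ => Finset.sum_nonneg fun k _ => sq_nonneg _) (Finset.mem_univ i)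
  simp_rw [fun i => sum_sum_mul_sub_mul_sq (B i) v, ← Finset.mul_sum, Finset.sum_sub_distrib,
    ← Finset.mul_sum] at h2
  calc _ ≤ ∑ k, (n : ℝ) * ∑ j, (B j j * v k - B j k * v j) ^ 2 :=
        Finset.sum_le_sum fun k _ => h1 k
    _ = n * ∑ k, ∑ j, (B j j * v k - B j k * v j) ^ 2 := by rw [Finset.mul_sum]
    _ ≤ n * _ := mul_le_mul_of_nonneg_left h2 (Nat.cast_nonneg n)
    _ = _ := by ring

lemma weighted_young {B : Fin n → Fin n → ℝ} (hB : ∀ i j, B i j = B j i) (g d : Fin n → ℝ)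
    {δ W P q L s z : ℝ} (hδ : 0 < δ) (hW : 0 ≤ W) (hs : 0 < s) (hL : 0 ≤ L)
    (hd : ∑ k, d k ^ 2 ≤ q) (hWP : W * q ≤ L * P ^ 2) :
    W * z ^ 2 * ∑ k, d k * ((∑ j, B j j) * g k - ∑ j, B k j * g j) ≤
      s / 2 * ((∑ i, ∑ j, B i j ^ 2 - (∑ i, (∑ j, B i j * g j) ^ 2) / (∑ j, g j ^ 2 + δ)) *
        (P * z) ^ 2) + n * L / s * ((∑ j, g j ^ 2) * W * z ^ 2) := by
  set S := ∑ j, g j ^ 2 with hS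
  set Q := ∑ i, (∑ j, B i j * g j) ^ 2 with hQ
  set N := ∑ i, ∑ j, B i j ^ 2 with hN
  set T : Fin n → ℝ := fun k => (∑ j, B j j) * g k - ∑ j, B k j * g j with hT
  have hS0 : 0 ≤ S := Finset.sum_nonneg fun j _ => sq_nonneg _
  have hQ0 : 0 ≤ Q := Finset.sum_nonneg fun j _ => sq_nonneg _
  have hq : 0 ≤ q := (Finset.sum_nonneg fun j _ => sq_nonneg _).trans hd
  have hQN : Q ≤ S * N := by
    rw [hQ, hN, Finset.mul_sum]
    refine Finset.sum_le_sum fun i _ => ?_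
    rw [mul_comm]
    exact Finset.sum_mul_sq_le_sq_mul_sq _ _ _
  have hT2 : ∑ k, T k ^ 2 ≤ 2 * n * (S * N - Q) := sum_trace_mul_sub_sq_le hB g
  set A := N - Q / (S + δ) with hA
  have hSA : S * N - Q ≤ S * A := by
    rw [hA, mul_sub, ← mul_div_assoc]
    have : S * Q / (S + δ) ≤ Q := by
      rw [div_le_iff₀ (by linarith)]
      nlinarith [mul_nonneg hQ0 hδ.le]
    linarith
  have hA0 : 0 ≤ A := by
    rw [hA, sub_nonneg, div_le_iff₀ (by linarith)]
    have hN0 : 0 ≤ N := Finset.sum_nonneg fun i _ => Finset.sum_nonneg fun j _ => sq_nonneg _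
    nlinarith
  set t := ∑ k, d k * T k with ht
  have hn0 : (0 : ℝ) ≤ n := Nat.cast_nonneg n
  have ht2 : t ^ 2 ≤ 2 * n * q * (S * A) := by
    calc t ^ 2 ≤ (∑ k, d k ^ 2) * ∑ k, T k ^ 2 := Finset.sum_mul_sq_le_sq_mul_sq _ _ _
      _ ≤ q * (2 * n * (S * N - Q)) :=
        mul_le_mul hd hT2 (Finset.sum_nonneg fun j _ => sq_nonneg _) hq
      _ ≤ q * (2 * n * (S * A)) := by gcongr
      _ = _ := by ring
  have hmain : W * t ≤ s / 2 * (A * P ^ 2) + n * L / s * (S * W) := by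
    refine abs_le_of_sq_le_sq' ?_ (by positivity) |>.2
    have e1 : (W * t) ^ 2 ≤ 2 * n * (S * A) * W * (L * P ^ 2) := by
      calc (W * t) ^ 2 = W ^ 2 * t ^ 2 := by ring
        _ ≤ W ^ 2 * (2 * n * q * (S * A)) := by gcongr
        _ = 2 * n * (S * A) * W * (W * q) := by ring
        _ ≤ _ := by gcongr
    have e2 : 2 * n * (S * A) * W * (L * P ^ 2) =
        4 * (s / 2 * (A * P ^ 2)) * (n * L / s * (S * W)) := by
      field_simp; ring
    nlinarith [sq_nonneg (s / 2 * (A * P ^ 2) - n * L / s * (S * W))]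
  calc W * z ^ 2 * t = (W * t) * z ^ 2 := by ring
    _ ≤ (s / 2 * (A * P ^ 2) + n * L / s * (S * W)) * z ^ 2 := by gcongr
    _ = _ := by ring

lemma drift_lower_bound (g d z : Fin n → ℝ) {b W W' q ζ χ c R D : ℝ} (hb : 0 ≤ b)
    (hW' : 0 ≤ W') (hW : 0 ≤ W) (hd : ∑ k, d k ^ 2 ≤ q) (hWq : W' * q = W)
    (hζ0 : 0 ≤ ζ) (hζ1 : ζ ≤ 1) (hc : 0 ≤ c) (hR : 0 ≤ R) (hD : 0 ≤ D)
    (hz : (∀ k, z k = 0) ∨ (χ = 1 ∧ W ≤ c ∧ ∑ k, d k ^ 2 ≤ R ∧ ∑ k, z k ^ 2 ≤ D)) :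
    -(2 * b * ((∑ k, g k ^ 2) * W * ζ ^ 2)) - 2 * c * (R + D) * ((∑ k, g k ^ 2) * χ ^ 2) ≤
      (∑ k, g k ^ 2) * ∑ j, d j * (-(2 * b * d j * W' * ζ ^ 2) + 2 * W * ζ * z j) -
        (∑ j, g j * (-(2 * b * d j * W' * ζ ^ 2) + 2 * W * ζ * z j)) * ∑ k, g k * d k := by
  set S := ∑ k, g k ^ 2 with hS
  have hS0 : 0 ≤ S := Finset.sum_nonneg fun j _ => sq_nonneg _
  have e1 : ∑ j, d j * (-(2 * b * d j * W' * ζ ^ 2) + 2 * W * ζ * z j) =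
      -(2 * b * W' * ζ ^ 2) * ∑ k, d k ^ 2 + 2 * W * ζ * ∑ k, d k * z k := by
    rw [Finset.mul_sum, Finset.mul_sum, ← Finset.sum_add_distrib]
    exact Finset.sum_congr rfl fun j _ => by ring
  have e2 : ∑ j, g j * (-(2 * b * d j * W' * ζ ^ 2) + 2 * W * ζ * z j) =
      -(2 * b * W' * ζ ^ 2) * ∑ k, g k * d k + 2 * W * ζ * ∑ k, g k * z k := by
    rw [Finset.mul_sum, Finset.mul_sum, ← Finset.sum_add_distrib]
    exact Finset.sum_congr rfl fun j _ => by ring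
  rw [e1, e2]
  have h1 : 2 * b * W' * ζ ^ 2 * S * ∑ k, d k ^ 2 ≤ 2 * b * (S * W * ζ ^ 2) := by
    calc _ ≤ 2 * b * W' * ζ ^ 2 * S * q := by gcongr
      _ = 2 * b * (S * (W' * q) * ζ ^ 2) := by ring
      _ = _ := by rw [hWq]
  have h2 : 0 ≤ 2 * b * W' * ζ ^ 2 * (∑ k, g k * d k) ^ 2 := by positivity
  have h3 : -(2 * c * (R + D) * (S * χ ^ 2)) ≤
      2 * W * ζ * (S * (∑ k, d k * z k) - (∑ k, g k * z k) * ∑ k, g k * d k) := by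
    rcases hz with hz | ⟨hχ, hWc, hdR, hzD⟩
    · have : 0 ≤ 2 * c * (R + D) * (S * χ ^ 2) := by positivity
      simpa [hz] using this
    · have i1 : (∑ k, d k * z k) ^ 2 ≤ (∑ k, d k ^ 2) * ∑ k, z k ^ 2 :=
        Finset.sum_mul_sq_le_sq_mul_sq _ _ _
      have i2 : (∑ k, g k * z k) ^ 2 ≤ S * ∑ k, z k ^ 2 := Finset.sum_mul_sq_le_sq_mul_sq _ _ _
      have i3 : (∑ k, g k * d k) ^ 2 ≤ S * ∑ k, d k ^ 2 := Finset.sum_mul_sq_le_sq_mul_sq _ _ _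
      have hd0 : 0 ≤ ∑ k, d k ^ 2 := Finset.sum_nonneg fun j _ => sq_nonneg _
      have hz0 : 0 ≤ ∑ k, z k ^ 2 := Finset.sum_nonneg fun j _ => sq_nonneg _
      have i4 : -((R + D) / 2) ≤ ∑ k, d k * z k := by
        refine (abs_le_of_sq_le_sq' ?_ (by positivity)).1
        nlinarith [mul_le_mul hdR hzD hz0 hR, sq_nonneg (R - D)]
      have i5 : (∑ k, g k * z k) * ∑ k, g k * d k ≤ S * (R + D) / 2 := by
        nlinarith [sq_nonneg ((∑ k, g k * z k) - ∑ k, g k * d k),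
          mul_le_mul_of_nonneg_left hdR hS0, mul_le_mul_of_nonneg_left hzD hS0]
      have i6 : -(S * (R + D)) ≤
          S * (∑ k, d k * z k) - (∑ k, g k * z k) * ∑ k, g k * d k := by
        nlinarith [mul_le_mul_of_nonneg_left i4 hS0]
      have i7 : W * ζ ≤ c := by nlinarith
      have i8 : 0 ≤ W * ζ := mul_nonneg hW hζ0
      have i9 : 0 ≤ S * (R + D) := by positivity
      rw [hχ]
      nlinarith [mul_le_mul_of_nonneg_left i6 i8, mul_le_mul_of_nonneg_right i7 i9]
  nlinarith

lemma cutoff_gradient_bound (d z : Fin n → ℝ) {α W P P' q ζ χ c D : ℝ}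
    (hd : ∑ k, d k ^ 2 ≤ q) (hc : 0 ≤ c) (hD : 0 ≤ D) (hα : α = 0 ∨ P' ^ 2 * q ≤ W)
    (hz : (∀ k, z k = 0) ∨ (χ = 1 ∧ P ^ 2 ≤ c ∧ ∑ k, z k ^ 2 ≤ D)) :
    ∑ i, (-(2 * α * d i * P') * ζ + P * z i) ^ 2 ≤
      8 * α ^ 2 * (W * ζ ^ 2) + 2 * c * D * χ ^ 2 := by
  have h1 : ∑ i, (-(2 * α * d i * P') * ζ + P * z i) ^ 2 ≤
      8 * α ^ 2 * ζ ^ 2 * P' ^ 2 * (∑ k, d k ^ 2) + 2 * P ^ 2 * ∑ k, z k ^ 2 := by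
    rw [Finset.mul_sum, Finset.mul_sum, ← Finset.sum_add_distrib]
    refine Finset.sum_le_sum fun i _ => ?_
    nlinarith [sq_nonneg (-(2 * α * d i * P') * ζ - P * z i)]
  have h2 : 8 * α ^ 2 * ζ ^ 2 * P' ^ 2 * (∑ k, d k ^ 2) ≤ 8 * α ^ 2 * (W * ζ ^ 2) := by
    rcases hα with rfl | hα
    · simp
    · calc _ ≤ 8 * α ^ 2 * ζ ^ 2 * P' ^ 2 * q := by gcongr
        _ = 8 * α ^ 2 * ζ ^ 2 * (P' ^ 2 * q) := by ring
        _ ≤ 8 * α ^ 2 * ζ ^ 2 * W := by gcongr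
        _ = _ := by ring
  have h3 : 2 * P ^ 2 * ∑ k, z k ^ 2 ≤ 2 * c * D * χ ^ 2 := by
    rcases hz with hz | ⟨hχ, hP, hzD⟩
    · simp only [hz]
      simp only [ne_eq, OfNat.ofNat_ne_zero, not_false_eq_true, zero_pow, Finset.sum_const_zero,
        mul_zero]
      positivity
    · rw [hχ]
      have : 0 ≤ ∑ k, z k ^ 2 := Finset.sum_nonneg fun j _ => sq_nonneg _
      nlinarith [mul_le_mul hP hzD this hc]
  linarith

end PointwiseInequalities

section WeightedEstimate

variable {n : ℕ}

lemma contDiff_coord_sub {k : WithTop ℕ∞} (y : EuclideanSpace ℝ (Fin n)) (j : Fin n) :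
    ContDiff ℝ k (fun x : EuclideanSpace ℝ (Fin n) => x j - y j) := by
  fun_prop

lemma pd_coord_sub (y x : EuclideanSpace ℝ (Fin n)) (i j : Fin n) :
    pd i (fun x : EuclideanSpace ℝ (Fin n) => x j - y j) x = if i = j then 1 else 0 := by
  have h : HasFDerivAt (fun x : EuclideanSpace ℝ (Fin n) => x j - y j)
      (EuclideanSpace.proj j : EuclideanSpace ℝ (Fin n) →L[ℝ] ℝ) x :=
    ((EuclideanSpace.proj j : EuclideanSpace ℝ (Fin n) →L[ℝ] ℝ).hasFDerivAt).sub_const _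
  rw [pd, h.fderiv]
  simp [eq_comm]

/-- The regularised squared distance to `y`. -/
def radSq (y : EuclideanSpace ℝ (Fin n)) (κ : ℝ) (x : EuclideanSpace ℝ (Fin n)) : ℝ :=
  ∑ j, (x j - y j) ^ 2 + κ

lemma radSq_eq (y : EuclideanSpace ℝ (Fin n)) (κ : ℝ) (x : EuclideanSpace ℝ (Fin n)) :
    radSq y κ x = ‖x - y‖ ^ 2 + κ := by
  simp [radSq, EuclideanSpace.norm_sq_eq]

lemma contDiff_radSq {k : WithTop ℕ∞} (y : EuclideanSpace ℝ (Fin n)) (κ : ℝ) :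
    ContDiff ℝ k (radSq y κ) := by
  unfold radSq; fun_prop

lemma radSq_pos (y : EuclideanSpace ℝ (Fin n)) {κ : ℝ} (hκ : 0 < κ)
    (x : EuclideanSpace ℝ (Fin n)) : 0 < radSq y κ x := by
  rw [radSq_eq]; positivity

lemma pd_radSq (y : EuclideanSpace ℝ (Fin n)) (κ : ℝ) (x : EuclideanSpace ℝ (Fin n))
    (i : Fin n) : pd i (radSq y κ) x = 2 * (x i - y i) := by
  have hd : ∀ j, DifferentiableAt ℝ (fun x : EuclideanSpace ℝ (Fin n) => x j - y j) x :=
    fun j => (contDiff_coord_sub (k := 1) y j).differentiable (by norm_num) x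
  have hd2 : ∀ j, DifferentiableAt ℝ (fun x : EuclideanSpace ℝ (Fin n) => (x j - y j) ^ 2) x :=
    fun j => (hd j).pow 2
  unfold radSq
  rw [pd_add (by fun_prop) (by fun_prop), pd_sum (fun j _ => hd2 j)]
  simp_rw [pd_sq (hd _), pd_coord_sub]
  simp [pd]

lemma contDiff_radSq_rpow {k : WithTop ℕ∞} (y : EuclideanSpace ℝ (Fin n)) {κ : ℝ} (hκ : 0 < κ)
    (p : ℝ) : ContDiff ℝ k (fun x => radSq y κ x ^ p) :=
  (contDiff_radSq y κ).rpow_const_of_ne fun x => (radSq_pos y hκ x).ne'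

lemma pd_radSq_rpow (y : EuclideanSpace ℝ (Fin n)) {κ : ℝ} (hκ : 0 < κ) (p : ℝ)
    (x : EuclideanSpace ℝ (Fin n)) (i : Fin n) :
    pd i (fun x => radSq y κ x ^ p) x = 2 * p * (x i - y i) * radSq y κ x ^ (p - 1) := by
  have := Real.hasDerivAt_rpow_const (x := radSq y κ x) (p := p) (Or.inl (radSq_pos y hκ x).ne')
  rw [pd_comp this ((contDiff_radSq (k := 1) y κ).differentiable (by norm_num) x), pd_radSq]
  ring

/-- Integrating the divergence of `|∇u|² X - (∇u ⬝ X) ∇u` for the radial field `X = m (x - y)`. -/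
lemma integral_radial_identity {u m : EuclideanSpace ℝ (Fin n) → ℝ} (hu : ContDiff ℝ 2 u)
    (hm : ContDiff ℝ 1 m) (hmc : HasCompactSupport m) (y : EuclideanSpace ℝ (Fin n)) :
    ∫ x, ((n - 1) * m x * (∑ k, pd k u x ^ 2)
      + ((∑ k, pd k u x ^ 2) * ∑ j, (x j - y j) * pd j m x
        - (∑ j, pd j u x * pd j m x) * ∑ k, pd k u x * (x k - y k))
      - m x * ∑ k, (x k - y k) * ((∑ j, pd j (pd j u) x) * pd k u x
        - ∑ j, pd k (pd j u) x * pd j u x)) = 0 := by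
  have hg : ∀ k, ContDiff ℝ 1 (pd k u) := fun k => hu.pd_one
  have hgd : ∀ k, Differentiable ℝ (pd k u) := fun k => (hg k).differentiable (by norm_num)
  have hdC : ∀ k, ContDiff ℝ 1 (fun x : EuclideanSpace ℝ (Fin n) => x k - y k) :=
    fun k => contDiff_coord_sub y k
  have hdd : ∀ k, Differentiable ℝ (fun x : EuclideanSpace ℝ (Fin n) => x k - y k) :=
    fun k => (hdC k).differentiable (by norm_num)
  set S : EuclideanSpace ℝ (Fin n) → ℝ := fun x => ∑ k, pd k u x ^ 2 with hS
  set G : EuclideanSpace ℝ (Fin n) → ℝ := fun x => ∑ k, pd k u x * (x k - y k) with hG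
  have hSC : ContDiff ℝ 1 S := ContDiff.sum fun j _ => (hg j).pow 2
  have hGC : ContDiff ℝ 1 G := ContDiff.sum fun j _ => (hg j).mul (hdC j)
  have hSd : Differentiable ℝ S := hSC.differentiable (by norm_num)
  have hGd : Differentiable ℝ G := hGC.differentiable (by norm_num)
  have hmd : Differentiable ℝ m := hm.differentiable (by norm_num)
  have hSpd : ∀ j x, pd j S x = ∑ k, 2 * pd k u x * pd j (pd k u) x := by
    intro j x
    have hgd2 : ∀ j, DifferentiableAt ℝ (fun y => pd j u y ^ 2) x := fun j => (hgd j x).pow 2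
    rw [hS, pd_sum (fun j _ => hgd2 j)]
    simp_rw [pd_sq (hgd _ x)]
  have hGpd : ∀ j x, pd j G x = ∑ k, pd j (pd k u) x * (x k - y k) + pd j u x := by
    intro j x
    have hgd2 : ∀ k, DifferentiableAt ℝ
        (fun x : EuclideanSpace ℝ (Fin n) => pd k u x * (x k - y k)) x :=
      fun k => (hgd k x).mul (hdd k x)
    rw [hG, pd_sum (fun j _ => hgd2 j)]
    simp_rw [pd_mul (hgd _ x) (hdd _ x), pd_coord_sub, Finset.sum_add_distrib]
    simp
  set F : Fin n → EuclideanSpace ℝ (Fin n) → ℝ :=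
    fun j x => m x * (S x * (x j - y j) - pd j u x * G x) with hF
  have hFC : ∀ j, ContDiff ℝ 1 (F j) := fun j =>
    hm.mul ((hSC.mul (hdC j)).sub ((hg j).mul hGC))
  have hFc : ∀ j, HasCompactSupport (F j) := fun j => hmc.mul_right
  have hFpd : ∀ j x, pd j (F j) x = pd j m x * (S x * (x j - y j) - pd j u x * G x) +
      m x * (pd j S x * (x j - y j) + S x - (pd j (pd j u) x * G x + pd j u x * pd j G x)) := by
    intro j x
    have a1 : DifferentiableAt ℝ (fun x => S x * (x j - y j)) x := (hSd x).mul (hdd j x)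
    have a2 : DifferentiableAt ℝ (fun x => pd j u x * G x) x := (hgd j x).mul (hGd x)
    have a3 : DifferentiableAt ℝ (fun x => S x * (x j - y j) - pd j u x * G x) x := a1.sub a2
    rw [hF, pd_mul (hmd x) a3, pd_sub a1 a2, pd_mul (hSd x) (hdd j x),
      pd_mul (hgd j x) (hGd x), pd_coord_sub]
    simp
  have h0 : ∫ x, ∑ j, pd j (F j) x = 0 := by
    rw [integral_finsetSum]
    · exact Finset.sum_eq_zero fun j _ => integral_pd_eq_zero (hFC j) (hFc j)
    · exact fun j _ => ((hFC j).continuous_pd).integrable_of_hasCompactSupport (hFc j).pd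
  rw [← h0]
  congr 1
  ext x
  simp_rw [hFpd, hSpd, hGpd]
  have hsymm : ∀ k j, pd k (pd j u) x = pd j (pd k u) x := fun k j => pd_comm hu
  have e1 : ∑ j, pd j m x * (S x * (x j - y j) - pd j u x * G x) =
      S x * ∑ j, (x j - y j) * pd j m x - (∑ j, pd j u x * pd j m x) * G x := by
    rw [Finset.mul_sum, Finset.sum_mul, ← Finset.sum_sub_distrib]
    exact Finset.sum_congr rfl fun j _ => by ring
  have e2 : ∑ j, (∑ k, 2 * pd k u x * pd j (pd k u) x) * (x j - y j) =
      2 * ∑ j, (x j - y j) * ∑ k, pd j (pd k u) x * pd k u x := by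
    rw [Finset.mul_sum]
    refine Finset.sum_congr rfl fun j _ => ?_
    rw [Finset.sum_mul, Finset.mul_sum, Finset.mul_sum]
    exact Finset.sum_congr rfl fun k _ => by ring
  have e3 : ∑ j, pd j u x * (∑ k, pd j (pd k u) x * (x k - y k) + pd j u x) =
      ∑ j, (x j - y j) * (∑ k, pd j (pd k u) x * pd k u x) + S x := by
    simp_rw [mul_add, Finset.sum_add_distrib, Finset.mul_sum]
    rw [Finset.sum_comm]
    congr 1
    · refine Finset.sum_congr rfl fun j _ => Finset.sum_congr rfl fun k _ => ?_
      rw [hsymm k j]; ring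
    · exact Finset.sum_congr rfl fun k _ => by ring
  have e4 : ∑ k, (x k - y k) * ((∑ j, pd j (pd j u) x) * pd k u x
        - ∑ j, pd k (pd j u) x * pd j u x) =
      (∑ j, pd j (pd j u) x) * G x - ∑ j, (x j - y j) * ∑ k, pd j (pd k u) x * pd k u x := by
    rw [hG, Finset.mul_sum, ← Finset.sum_sub_distrib]
    exact Finset.sum_congr rfl fun k _ => by ring
  rw [e4, Finset.sum_add_distrib, e1, ← Finset.mul_sum, Finset.sum_sub_distrib,
    Finset.sum_add_distrib, Finset.sum_add_distrib, e2, e3, ← Finset.sum_mul]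
  simp
  ring

end WeightedEstimate

section InteriorWeightedEstimate

variable {n : ℕ}

/-- A weighted Dirichlet integral of a stable solution is controlled by the unweighted one over
the set where the cutoff varies. -/
lemma weighted_dirichlet_le {O : Set (EuclideanSpace ℝ (Fin n))} {f : ℝ → ℝ}
    {u ζ χ : EuclideanSpace ℝ (Fin n) → ℝ}
    (hu : ContDiff ℝ 2 u) (huc : HasCompactSupport u) (hf : ContDiff ℝ 1 f)
    (heq : ∀ x ∈ O, ∑ j, pd j (pd j u) x + f (u x) = 0)
    (hstab : ∀ ξ : EuclideanSpace ℝ (Fin n) → ℝ, ContDiff ℝ 1 ξ → HasCompactSupport ξ →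
      tsupport ξ ⊆ O → ∫ x, deriv f (u x) * ξ x ^ 2 ≤ ∫ x, ∑ i, pd i ξ x ^ 2)
    (hζ : ContDiff ℝ 1 ζ) (hζc : HasCompactSupport ζ) (hζO : tsupport ζ ⊆ O)
    (hζ0 : ∀ x, 0 ≤ ζ x) (hζ1 : ∀ x, ζ x ≤ 1) (hχ : Continuous χ) (hχc : HasCompactSupport χ)
    (hζχ : ∀ x, (∀ k, pd k ζ x = 0) ∨ χ x = 1)
    {y : EuclideanSpace ℝ (Fin n)} {κ σ R D b α s L : ℝ}
    (hD : ∀ x, ∑ k, pd k ζ x ^ 2 ≤ D) (hκ : 0 < κ) (hσ : 0 < σ)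
    (hχσ : ∀ x, χ x = 1 → σ ≤ radSq y κ x) (hR0 : 0 ≤ R)
    (hR : ∀ x ∈ tsupport ζ, ∑ j, (x j - y j) ^ 2 ≤ R)
    (hb : 0 ≤ b) (hα0 : 0 ≤ α) (hs : 0 < s) (hL0 : 0 ≤ L)
    (hL : ∀ x ∈ tsupport ζ, radSq y κ x ^ (-b) * radSq y κ x ≤ L * (radSq y κ x ^ (-α)) ^ 2)
    (hα : α = 0 ∨ b = 2 * α + 1)
    (hpar : 1 / 4 ≤ n - 1 - 2 * b - 4 * s * α ^ 2 - n * L / s) :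
    ∫ x, (∑ k, pd k u x ^ 2) * radSq y κ x ^ (-b) * ζ x ^ 2 ≤
      4 * (2 * σ ^ (-b) * (R + D) + s * σ ^ (-(2 * α)) * D) *
        ∫ x, (∑ k, pd k u x ^ 2) * χ x ^ 2 := by
  have hg : ∀ k, ContDiff ℝ 1 (pd k u) := fun k => hu.pd_one
  have hgc : ∀ k, Continuous (pd k u) := fun k => (hg k).continuous
  have hBc : ∀ k l, Continuous (pd k (pd l u)) := fun k l => (hg l).continuous_pd
  have hq : ∀ x, 0 < radSq y κ x := radSq_pos y hκ
  have hW : ∀ p : ℝ, ContDiff ℝ 1 (fun x => radSq y κ x ^ p) := contDiff_radSq_rpow y hκ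
  have hWd : ∀ p : ℝ, Differentiable ℝ (fun x => radSq y κ x ^ p) := fun p =>
    (hW p).differentiable (by norm_num)
  have hWc : ∀ p : ℝ, Continuous (fun x => radSq y κ x ^ p) := fun p => (hW p).continuous
  have hζd : Differentiable ℝ ζ := hζ.differentiable (by norm_num)
  have hζcont : Continuous ζ := hζ.continuous
  have hζ2d : Differentiable ℝ (fun x => ζ x ^ 2) := hζd.pow 2
  have hD0 : 0 ≤ D := (Finset.sum_nonneg fun k _ => sq_nonneg (pd k ζ 0)).trans (hD 0)
  set m : EuclideanSpace ℝ (Fin n) → ℝ := fun x => radSq y κ x ^ (-b) * ζ x ^ 2 with hm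
  set η : EuclideanSpace ℝ (Fin n) → ℝ := fun x => radSq y κ x ^ (-α) * ζ x with hη
  have hmC : ContDiff ℝ 1 m := (hW _).mul (hζ.pow 2)
  have hηC : ContDiff ℝ 1 η := (hW _).mul hζ
  have hζ2c : HasCompactSupport fun x => ζ x ^ 2 := by
    simp only [sq]; exact hζc.mul_right
  have hmc : HasCompactSupport m := hζ2c.mul_left
  have hηc : HasCompactSupport η := hζc.mul_left
  have hηO : tsupport η ⊆ O := (tsupport_mul_subset_right).trans hζO
  have hmpd : ∀ j x, pd j m x = -(2 * b * (x j - y j) * radSq y κ x ^ (-b - 1) * ζ x ^ 2) +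
      2 * radSq y κ x ^ (-b) * ζ x * pd j ζ x := fun j x => by
    rw [hm, pd_mul (hWd _ x) (hζ2d x), pd_radSq_rpow y hκ, pd_sq (hζd x)]; ring
  have hηpd : ∀ j x, pd j η x = -(2 * α * (x j - y j) * radSq y κ x ^ (-α - 1)) * ζ x +
      radSq y κ x ^ (-α) * pd j ζ x := fun j x => by
    rw [hη, pd_mul (hWd _ x) (hζd x), pd_radSq_rpow y hκ]; ring
  have hζt : ∀ x ∉ tsupport ζ, ζ x = 0 := fun x hx => image_eq_zero_of_notMem_tsupport hx
  have hζz : ∀ x, (∀ k, pd k ζ x = 0) ∨ (χ x = 1 ∧ x ∈ tsupport ζ) := fun x => by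
    by_cases hx : x ∈ tsupport ζ
    · exact (hζχ x).imp_right fun h => ⟨h, hx⟩
    · exact Or.inl fun k => pd_eq_zero_of_notMem_tsupport hx
  set S : EuclideanSpace ℝ (Fin n) → ℝ := fun x => ∑ k, pd k u x ^ 2 with hS
  have hS0 : ∀ x, 0 ≤ S x := fun x => Finset.sum_nonneg fun k _ => sq_nonneg _
  have hdq : ∀ x, ∑ k, (x k - y k) ^ 2 ≤ radSq y κ x := fun x => by
    rw [radSq]; linarith
  set Q : EuclideanSpace ℝ (Fin n) → ℝ := fun x => (n - 1) * m x * S x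
      + (S x * ∑ j, (x j - y j) * pd j m x
        - (∑ j, pd j u x * pd j m x) * ∑ k, pd k u x * (x k - y k))
      - m x * ∑ k, (x k - y k) * ((∑ j, pd j (pd j u) x) * pd k u x
        - ∑ j, pd k (pd j u) x * pd j u x) with hQ
  have hQ0 : ∫ x, Q x = 0 := integral_radial_identity hu hmC hmc y
  set C := 2 * σ ^ (-b) * (R + D) + s * σ ^ (-(2 * α)) * D with hC
  set e : EuclideanSpace ℝ (Fin n) → ℝ :=
    fun x => ∑ i, pd i η x ^ 2 + |deriv f (u x)| * η x ^ 2 with he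
  set A : ℝ → EuclideanSpace ℝ (Fin n) → ℝ := fun δ x =>
    (∑ i, ∑ j, pd i (pd j u) x ^ 2 - (∑ i, (∑ j, pd i (pd j u) x * pd j u x) ^ 2) /
        (∑ j, pd j u x ^ 2 + δ)) * η x ^ 2 with hA
  have hpt : ∀ δ : ℝ, 0 < δ → ∀ x, 1 / 4 * (S x * radSq y κ x ^ (-b) * ζ x ^ 2)
      - C * (S x * χ x ^ 2) ≤
      Q x + s / 2 * (A δ x - (S x * ∑ i, pd i η x ^ 2 + δ * e x)) + s / 2 * δ * e x := by
    intro δ hδ x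
    have h1 := drift_lower_bound (fun k => pd k u x) (fun k => x k - y k) (fun k => pd k ζ x)
      (b := b) (W := radSq y κ x ^ (-b)) (W' := radSq y κ x ^ (-b - 1)) (q := radSq y κ x)
      (ζ := ζ x) (χ := χ x) (c := σ ^ (-b)) (R := R) (D := D) hb
      (Real.rpow_nonneg (hq x).le _) (Real.rpow_nonneg (hq x).le _) (hdq x)
      (by rw [Real.rpow_sub_one (hq x).ne']; field_simp [(hq x).ne'])
      (hζ0 x) (hζ1 x) (Real.rpow_nonneg hσ.le _) hR0 hD0
      ((hζz x).imp_right fun h => ⟨h.1, Real.rpow_le_rpow_of_nonpos hσ (hχσ x h.1)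
        (by linarith), hR x h.2, hD x⟩)
    have h2 : m x * ∑ k, (x k - y k) * ((∑ j, pd j (pd j u) x) * pd k u x
        - ∑ j, pd k (pd j u) x * pd j u x) ≤
        s / 2 * A δ x + n * L / s * (S x * radSq y κ x ^ (-b) * ζ x ^ 2) := by
      by_cases hx : x ∈ tsupport ζ
      · exact weighted_young (B := fun i j => pd i (pd j u) x) (fun i j => pd_comm hu)
          (fun k => pd k u x) (fun k => x k - y k) hδ (Real.rpow_nonneg (hq x).le _) hs hL0
          (hdq x) (hL x hx)
      · simp [hm, hA, hη, hζt x hx]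
    have h3 := cutoff_gradient_bound (fun k => x k - y k) (fun k => pd k ζ x)
      (α := α) (W := radSq y κ x ^ (-b)) (P := radSq y κ x ^ (-α))
      (P' := radSq y κ x ^ (-α - 1)) (q := radSq y κ x)
      (ζ := ζ x) (χ := χ x) (c := σ ^ (-(2 * α))) (D := D) (hdq x)
      (Real.rpow_nonneg hσ.le _) hD0
      (hα.imp_right fun h => by
        rw [← Real.rpow_natCast, ← Real.rpow_mul (hq x).le, ← Real.rpow_add_one (hq x).ne', h]
        refine le_of_eq ?_
        congr 1
        push_cast
        ring)
      ((hζz x).imp_right fun h => ⟨h.1, by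
        rw [← Real.rpow_natCast, ← Real.rpow_mul (hq x).le]
        calc _ = radSq y κ x ^ (-(2 * α)) := by congr 1; push_cast; ring
          _ ≤ _ := Real.rpow_le_rpow_of_nonpos hσ (hχσ x h.1) (by linarith), hD x⟩)
    simp_rw [← hmpd] at h1
    simp_rw [← hηpd] at h3
    have h4 := mul_le_mul_of_nonneg_left h3 (mul_nonneg (half_pos hs).le (hS0 x))
    have h5 : 0 ≤ S x * radSq y κ x ^ (-b) * ζ x ^ 2 :=
      mul_nonneg (mul_nonneg (hS0 x) (Real.rpow_nonneg (hq x).le _)) (sq_nonneg _)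
    have h6 := mul_le_mul_of_nonneg_right hpar h5
    change _ ≤ S x * _ - _ at h1
    have h7 : (n - 1) * m x * S x = (n - 1) * (S x * radSq y κ x ^ (-b) * ζ x ^ 2) := by
      rw [hm]; ring
    rw [hQ, hC]
    simp only
    rw [h7]
    linarith
  have hint1 : Integrable fun x => S x * radSq y κ x ^ (-b) * ζ x ^ 2 :=
    integrable_of_eq_zero_off_tsupport (by fun_prop) hζc fun x hx => by simp [hζt x hx]
  have hint2 : Integrable fun x => S x * χ x ^ 2 :=
    integrable_of_eq_zero_off_tsupport (by fun_prop) hχc fun x hx => by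
      simp [image_eq_zero_of_notMem_tsupport hx]
  have hmpc : ∀ j, Continuous (pd j m) := fun j => hmC.continuous_pd
  have hηpc : ∀ j, Continuous (pd j η) := fun j => hηC.continuous_pd
  have hmcont := hmC.continuous
  have hηcont := hηC.continuous
  have hf' : Continuous fun x => deriv f (u x) := (hf.continuous_deriv le_rfl).comp hu.continuous
  have hm0 : ∀ x ∉ tsupport m, m x = 0 := fun x hx => image_eq_zero_of_notMem_tsupport hx
  have hη0 : ∀ x ∉ tsupport η, η x = 0 := fun x hx => image_eq_zero_of_notMem_tsupport hx
  have hpm0 : ∀ j, ∀ x ∉ tsupport m, pd j m x = 0 := fun j x hx =>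
    pd_eq_zero_of_notMem_tsupport hx
  have hpη0 : ∀ j, ∀ x ∉ tsupport η, pd j η x = 0 := fun j x hx =>
    pd_eq_zero_of_notMem_tsupport hx
  have hSc : Continuous S := by fun_prop
  have hQi : Integrable Q :=
    integrable_of_eq_zero_off_tsupport (by fun_prop) hmc fun x hx => by
      simp [hQ, hm0 x hx, hpm0 _ x hx]
  have hei : Integrable e :=
    integrable_of_eq_zero_off_tsupport (by fun_prop) hηc fun x hx => by
      simp [he, hη0 x hx, hpη0 _ x hx]
  have hSei : ∀ δ : ℝ, Integrable fun x => S x * ∑ i, pd i η x ^ 2 + δ * e x := fun δ =>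
    integrable_of_eq_zero_off_tsupport (by fun_prop) hηc fun x hx => by
      simp [he, hη0 x hx, hpη0 _ x hx]
  have hAi : ∀ δ : ℝ, 0 < δ → Integrable (A δ) := fun δ hδ => by
    have hpos : ∀ x, S x + δ ≠ 0 := fun x => by have := hS0 x; positivity
    have hdiv : Continuous fun x => (∑ i, (∑ j, pd i (pd j u) x * pd j u x) ^ 2) / (S x + δ) :=
      (by fun_prop : Continuous fun x => ∑ i, (∑ j, pd i (pd j u) x * pd j u x) ^ 2).div
        (by fun_prop) hpos
    exact integrable_of_eq_zero_off_tsupport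
      (((by fun_prop : Continuous fun x => ∑ i, ∑ j, pd i (pd j u) x ^ 2).sub hdiv).mul
        (hηcont.pow 2)) hηc fun x hx => by simp [hA, hη0 x hx]
  have hδ : ∀ δ : ℝ, 0 < δ → 1 / 4 * (∫ x, S x * radSq y κ x ^ (-b) * ζ x ^ 2)
      - C * ∫ x, S x * χ x ^ 2 ≤ δ * (s / 2 * ∫ x, e x) := by
    intro δ hδ
    have hgs := geometric_stability hu huc hf heq hstab hηC hηc hηO hδ
    have j1 : Integrable fun x => s / 2 * (A δ x - (S x * ∑ i, pd i η x ^ 2 + δ * e x)) :=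
      ((hAi δ hδ).sub (hSei δ)).const_mul _
    have j2 : Integrable fun x => Q x + s / 2 * (A δ x - (S x * ∑ i, pd i η x ^ 2 + δ * e x)) :=
      hQi.add j1
    have hmono := integral_mono ((hint1.const_mul (1 / 4)).sub (hint2.const_mul C))
      (j2.add (hei.const_mul (s / 2 * δ))) (hpt δ hδ)
    simp only [Pi.sub_apply, Pi.add_apply] at hmono
    rw [integral_sub (hint1.const_mul _) (hint2.const_mul _), integral_const_mul,
      integral_const_mul, integral_add j2 (hei.const_mul _), integral_const_mul,
      integral_add hQi j1, hQ0, integral_const_mul, integral_sub (hAi δ hδ) (hSei δ)] at hmono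
    have := mul_nonneg (half_pos hs).le (sub_nonneg.2 hgs)
    linarith
  have hle : 1 / 4 * (∫ x, S x * radSq y κ x ^ (-b) * ζ x ^ 2) - C * ∫ x, S x * χ x ^ 2 ≤ 0 := by
    by_contra! h
    set N := s / 2 * ∫ x, e x
    set X := 1 / 4 * (∫ x, S x * radSq y κ x ^ (-b) * ζ x ^ 2) - C * ∫ x, S x * χ x ^ 2
    have hN := hδ (X / (2 * (|N| + 1))) (by positivity)
    have h1 : X / (2 * (|N| + 1)) * N ≤ X / (2 * (|N| + 1)) * (|N| + 1) := by
      gcongr; linarith [le_abs_self N]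
    have h2 : X / (2 * (|N| + 1)) * (|N| + 1) = X / 2 := by
      field_simp
    linarith
  linarith

end InteriorWeightedEstimate

section Representation

variable {n : ℕ}

/-- Caccioppoli's inequality. -/
lemma integral_gradSq_mul_sq_le {O : Set (EuclideanSpace ℝ (Fin n))} {f : ℝ → ℝ}
    {u χ : EuclideanSpace ℝ (Fin n) → ℝ} (hu : ContDiff ℝ 2 u)
    (heq : ∀ x ∈ O, ∑ j, pd j (pd j u) x + f (u x) = 0)
    (hχ : ContDiff ℝ 1 χ) (hχc : HasCompactSupport χ) (hχO : tsupport χ ⊆ O) {c M : ℝ}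
    (huc : ∀ x, χ x ≠ 0 → |u x| ≤ c) (hfM : ∀ x, χ x ≠ 0 → |f (u x)| ≤ M) :
    ∫ x, (∑ k, pd k u x ^ 2) * χ x ^ 2 ≤
      ∫ x, (2 * M * c * χ x ^ 2 + 4 * c ^ 2 * ∑ k, pd k χ x ^ 2) := by
  have hg : ∀ k, ContDiff ℝ 1 (pd k u) := fun k => hu.pd_one
  have hgc : ∀ k, Continuous (pd k u) := fun k => (hg k).continuous
  have hχpc : ∀ k, Continuous (pd k χ) := fun k => hχ.continuous_pd
  have hχcont : Continuous χ := hχ.continuous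
  have hu1 : ContDiff ℝ 1 u := hu.of_le (by norm_num)
  have hχ0 : ∀ x ∉ tsupport χ, χ x = 0 := fun x hx => image_eq_zero_of_notMem_tsupport hx
  have hpχ0 : ∀ j, ∀ x ∉ tsupport χ, pd j χ x = 0 := fun j x hx =>
    pd_eq_zero_of_notMem_tsupport hx
  have hχ2c : HasCompactSupport fun x => χ x ^ 2 := by
    simp only [sq]; exact hχc.mul_right
  have hφ : ContDiff ℝ 1 fun x => u x * χ x ^ 2 := hu1.mul (hχ.pow 2)
  have hφd : Differentiable ℝ fun x => u x * χ x ^ 2 := hφ.differentiable (by norm_num)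
  have hφc : HasCompactSupport fun x => u x * χ x ^ 2 := hχ2c.mul_left
  set F : Fin n → EuclideanSpace ℝ (Fin n) → ℝ := fun j x => pd j u x * (u x * χ x ^ 2) with hF
  have hFC : ∀ j, ContDiff ℝ 1 (F j) := fun j => (hg j).mul hφ
  have hFc : ∀ j, HasCompactSupport (F j) := fun j => hφc.mul_left
  have hFpd : ∀ j x, pd j (F j) x = pd j (pd j u) x * (u x * χ x ^ 2) +
      pd j u x * (pd j u x * χ x ^ 2 + u x * (2 * χ x * pd j χ x)) := by
    intro j x
    have hud : DifferentiableAt ℝ u x := hu1.differentiable (by norm_num) x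
    have hχd : DifferentiableAt ℝ χ x := hχ.differentiable (by norm_num) x
    have hχ2d : DifferentiableAt ℝ (fun x => χ x ^ 2) x := hχd.pow 2
    rw [hF, pd_mul ((hg j).differentiable (by norm_num) x) (hφd x), pd_mul hud hχ2d, pd_sq hχd]
  have hFi : ∀ j, Integrable (pd j (F j)) := fun j =>
    ((hFC j).continuous_pd).integrable_of_hasCompactSupport (hFc j).pd
  have h0 : ∫ x, ∑ j, pd j (F j) x = 0 := by
    rw [integral_finsetSum]
    · exact Finset.sum_eq_zero fun j _ => integral_pd_eq_zero (hFC j) (hFc j)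
    · exact fun j _ => hFi j
  have hpt : ∀ x, (∑ k, pd k u x ^ 2) * χ x ^ 2 ≤
      2 * ∑ j, pd j (F j) x + (2 * M * c * χ x ^ 2 + 4 * c ^ 2 * ∑ k, pd k χ x ^ 2) := by
    intro x
    by_cases hx : χ x = 0
    · have : 0 ≤ 4 * c ^ 2 * ∑ k, pd k χ x ^ 2 := by positivity
      simpa [hFpd, hx] using this
    have hxO : x ∈ O := hχO (subset_tsupport χ hx)
    have e1 : ∑ j, pd j (F j) x = -(f (u x) * u x) * χ x ^ 2 +
        ∑ j, (pd j u x ^ 2 * χ x ^ 2 + 2 * (pd j u x * χ x) * (u x * pd j χ x)) := by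
      simp_rw [hFpd]
      rw [Finset.sum_add_distrib, ← Finset.sum_mul, eq_neg_of_add_eq_zero_left (heq x hxO)]
      congr 1
      · ring
      · exact Finset.sum_congr rfl fun k _ => by ring
    have e2 : (∑ k, pd k u x ^ 2) * χ x ^ 2 ≤
        2 * ∑ j, (pd j u x ^ 2 * χ x ^ 2 + 2 * (pd j u x * χ x) * (u x * pd j χ x))
          + 4 * c ^ 2 * ∑ k, pd k χ x ^ 2 := by
      rw [Finset.sum_mul, Finset.mul_sum, Finset.mul_sum, ← Finset.sum_add_distrib]
      refine Finset.sum_le_sum fun k _ => ?_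
      have hu2 : u x ^ 2 ≤ c ^ 2 := sq_le_sq' (abs_le.1 (huc x hx)).1 (abs_le.1 (huc x hx)).2
      nlinarith [sq_nonneg (pd k u x * χ x + 2 * (u x * pd k χ x)),
        mul_le_mul_of_nonneg_right hu2 (sq_nonneg (pd k χ x))]
    have e3 : f (u x) * u x ≤ M * c := by
      refine (le_abs_self _).trans ?_
      rw [abs_mul]
      exact mul_le_mul (hfM x hx) (huc x hx) (abs_nonneg _) ((abs_nonneg _).trans (hfM x hx))
    rw [e1]
    nlinarith [mul_le_mul_of_nonneg_right e3 (sq_nonneg (χ x))]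
  have i1 : Integrable fun x => (∑ k, pd k u x ^ 2) * χ x ^ 2 :=
    integrable_of_eq_zero_off_tsupport (by fun_prop) hχc fun x hx => by simp [hχ0 x hx]
  have i2 : Integrable fun x => 2 * M * c * χ x ^ 2 + 4 * c ^ 2 * ∑ k, pd k χ x ^ 2 :=
    integrable_of_eq_zero_off_tsupport (by fun_prop) hχc fun x hx => by
      simp [hχ0 x hx, hpχ0 _ x hx]
  have i3 : Integrable fun x => 2 * ∑ j, pd j (F j) x :=
    (integrable_finsetSum _ fun j _ => hFi j).const_mul _
  have hmono := integral_mono i1 (i3.add i2) hpt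
  simp only [Pi.add_apply] at hmono
  rw [integral_add i3 i2, integral_const_mul, h0] at hmono
  linarith

/-- A representation of `v` through the gradient field of the fundamental solution,
regularised at scale `√κ`. -/
lemma integral_mul_radSq_rpow {v : EuclideanSpace ℝ (Fin n) → ℝ} (hv : ContDiff ℝ 1 v)
    (hvc : HasCompactSupport v) (y : EuclideanSpace ℝ (Fin n)) {κ : ℝ} (hκ : 0 < κ) :
    ∫ x, v x * (n * κ * radSq y κ x ^ (-(n / 2 : ℝ) - 1)) =
      -∫ x, (∑ j, pd j v x * (x j - y j)) * radSq y κ x ^ (-(n / 2 : ℝ)) := by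
  have hdC : ∀ k, ContDiff ℝ 1 (fun x : EuclideanSpace ℝ (Fin n) => x k - y k) :=
    fun k => contDiff_coord_sub y k
  have hdd : ∀ k, Differentiable ℝ (fun x : EuclideanSpace ℝ (Fin n) => x k - y k) :=
    fun k => (hdC k).differentiable (by norm_num)
  have hW : ContDiff ℝ 1 (fun x => radSq y κ x ^ (-(n / 2 : ℝ))) := contDiff_radSq_rpow y hκ _
  have hWd := hW.differentiable (by norm_num)
  have hvd : Differentiable ℝ v := hv.differentiable (by norm_num)
  have hWC : ∀ j, ContDiff ℝ 1
      (fun x : EuclideanSpace ℝ (Fin n) => (x j - y j) * radSq y κ x ^ (-(n / 2 : ℝ))) := fun j =>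
    (hdC j).mul hW
  set F : Fin n → EuclideanSpace ℝ (Fin n) → ℝ := fun j x =>
    v x * ((x j - y j) * radSq y κ x ^ (-(n / 2 : ℝ))) with hF
  have hFC : ∀ j, ContDiff ℝ 1 (F j) := fun j => hv.mul (hWC j)
  have hFc : ∀ j, HasCompactSupport (F j) := fun j => hvc.mul_right
  have hFi : ∀ j, Integrable (pd j (F j)) := fun j =>
    ((hFC j).continuous_pd).integrable_of_hasCompactSupport (hFc j).pd
  have h0 : ∫ x, ∑ j, pd j (F j) x = 0 := by
    rw [integral_finsetSum]
    · exact Finset.sum_eq_zero fun j _ => integral_pd_eq_zero (hFC j) (hFc j)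
    · exact fun j _ => hFi j
  have hpt : ∀ x, ∑ j, pd j (F j) x =
      (∑ j, pd j v x * (x j - y j)) * radSq y κ x ^ (-(n / 2 : ℝ)) +
        v x * (n * κ * radSq y κ x ^ (-(n / 2 : ℝ) - 1)) := by
    intro x
    have hq := radSq_pos y hκ x
    have e1 : ∀ j, pd j (F j) x = pd j v x * (x j - y j) * radSq y κ x ^ (-(n / 2 : ℝ)) +
        v x * (radSq y κ x ^ (-(n / 2 : ℝ)) - n * radSq y κ x ^ (-(n / 2 : ℝ) - 1)
          * (x j - y j) ^ 2) := fun j => by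
      rw [hF, pd_mul (hvd x) ((hWC j).differentiable (by norm_num) x), pd_mul (hdd j x) (hWd x),
        pd_radSq_rpow y hκ, pd_coord_sub, if_pos rfl]
      ring
    have e2 : radSq y κ x ^ (-(n / 2 : ℝ)) = radSq y κ x ^ (-(n / 2 : ℝ) - 1) * radSq y κ x := by
      rw [← Real.rpow_add_one hq.ne']; congr 1; ring
    have e3 : ∑ j, (x j - y j) ^ 2 = radSq y κ x - κ := by rw [radSq]; ring
    simp_rw [e1, Finset.sum_add_distrib, ← Finset.sum_mul, ← Finset.mul_sum,
      Finset.sum_sub_distrib, ← Finset.mul_sum, e3]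
    simp only [Finset.sum_const, Finset.card_univ, Fintype.card_fin, nsmul_eq_mul]
    rw [e2]
    ring
  simp_rw [hpt] at h0
  have hv0 : ∀ x ∉ tsupport v, v x = 0 := fun x hx => image_eq_zero_of_notMem_tsupport hx
  have hpv0 : ∀ j, ∀ x ∉ tsupport v, pd j v x = 0 := fun j x hx =>
    pd_eq_zero_of_notMem_tsupport hx
  have hvp : ∀ j, Continuous (pd j v) := fun j => hv.continuous_pd
  have hWc := hW.continuous
  have hWc1 : Continuous (fun x => radSq y κ x ^ (-(n / 2 : ℝ) - 1)) :=
    (contDiff_radSq_rpow (k := 1) y hκ _).continuous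
  have hvcont := hv.continuous
  rw [integral_add] at h0
  · linarith
  · exact integrable_of_eq_zero_off_tsupport (by fun_prop) hvc fun x hx => by simp [hpv0 _ x hx]
  · exact integrable_of_eq_zero_off_tsupport (by fun_prop) hvc fun x hx => by simp [hv0 x hx]

/-- Powers of the regularised distance are integrable on balls, uniformly in the centre and in
the regularisation. -/
lemma exists_setIntegral_radSq_rpow_le (hn : 1 ≤ n) {p : ℝ} (hp0 : p ≤ 0) (hp : -(n : ℝ) < 2 * p)
    (r : ℝ) : ∃ I : ℝ, ∀ (y : EuclideanSpace ℝ (Fin n)) (κ : ℝ), 0 < κ →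
      ∫ x in Metric.ball y r, radSq y κ x ^ p ≤ I := by
  refine ⟨∫ x in Metric.ball (0 : EuclideanSpace ℝ (Fin n)) r, ‖x‖ ^ (2 * p), fun y κ hκ => ?_⟩
  have : Nonempty (Fin n) := ⟨⟨0, hn⟩⟩
  have hI : IntegrableOn (fun x : EuclideanSpace ℝ (Fin n) => ‖x‖ ^ (2 * p))
      (Metric.ball 0 r) := by
    refine integrableOn_ball_of_norm_le_rpow (C := 1) (α := -(2 * p)) (by simpa using hn)
      (by simpa using by linarith) (Eventually.of_forall fun x => ?_)
      (measurable_norm.pow_const _).aestronglyMeasurable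
    simp [abs_of_nonneg (Real.rpow_nonneg (norm_nonneg x) _)]
  have hball : (fun x => x + y) ⁻¹' Metric.ball y r = Metric.ball 0 r := by
    ext x; simp
  have e1 : ∫ x in Metric.ball y r, radSq y κ x ^ p =
      ∫ x in Metric.ball (0 : EuclideanSpace ℝ (Fin n)) r, (‖x‖ ^ 2 + κ) ^ p := by
    rw [← hball, (measurePreserving_add_right volume y).setIntegral_preimage_emb
      (measurableEmbedding_addRight y) (fun x => radSq y κ x ^ p) (Metric.ball y r) |>.symm]
    simp [radSq_eq]
  rw [e1]
  refine integral_mono_of_nonneg (Eventually.of_forall fun x => by positivity) hI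
    (ae_restrict_of_ae ?_)
  filter_upwards [compl_mem_ae_iff.2 (measure_singleton (0 : EuclideanSpace ℝ (Fin n)))] with x hx
  have hx0 : 0 < ‖x‖ := norm_pos_iff.2 hx
  rw [Real.rpow_mul hx0.le, Real.rpow_two]
  exact Real.rpow_le_rpow_of_nonpos (by positivity) (by linarith) hp0

end Representation

section ValueBound

variable {n : ℕ}

lemma neg_sum_mul_rpow_le {u ζ : EuclideanSpace ℝ (Fin n) → ℝ} {y x : EuclideanSpace ℝ (Fin n)}
    {κ σ R D b c χ : ℝ} (hκ : 0 < κ) (hσ : 0 < σ)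
    (hud : DifferentiableAt ℝ u x) (hζd : DifferentiableAt ℝ ζ x)
    (hζ : (∀ k, pd k ζ x = 0) ∨ (χ = 1 ∧ |u x| ≤ c ∧ σ ≤ radSq y κ x))
    (hR : ∑ j, (x j - y j) ^ 2 ≤ R) (hD : ∑ k, pd k ζ x ^ 2 ≤ D) (hc : 0 ≤ c) :
    -((∑ j, pd j (fun x => u x * ζ x) x * (x j - y j)) * radSq y κ x ^ (-(n / 2 : ℝ))) ≤
      1 / 2 * ((∑ k, pd k u x ^ 2) * radSq y κ x ^ (-b) * ζ x ^ 2)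
        + 1 / 2 * radSq y κ x ^ (1 - n + b) + c * (R + D) / 2 * σ ^ (-(n / 2 : ℝ)) * χ ^ 2 := by
  have hq := radSq_pos y hκ x
  set q := radSq y κ x with hqdef
  set P := q ^ (-(n / 2 : ℝ)) with hP
  set W := q ^ (-b) with hW
  set V := q ^ (1 - n + b) with hV
  set S := ∑ k, pd k u x ^ 2 with hS
  have hP0 : 0 ≤ P := Real.rpow_nonneg hq.le _
  have hW0 : 0 ≤ W := Real.rpow_nonneg hq.le _
  have hV0 : 0 ≤ V := Real.rpow_nonneg hq.le _
  have hS0 : 0 ≤ S := Finset.sum_nonneg fun _ _ => sq_nonneg _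
  have hPq : P ^ 2 * q = W * V := by
    rw [hP, hW, hV, ← Real.rpow_add hq, ← Real.rpow_natCast, ← Real.rpow_mul hq.le,
      ← Real.rpow_add_one hq.ne']
    congr 1
    push_cast
    ring
  have e1 : ∑ j, pd j (fun x => u x * ζ x) x * (x j - y j) =
      ζ x * (∑ j, pd j u x * (x j - y j)) + u x * ∑ j, pd j ζ x * (x j - y j) := by
    simp_rw [pd_mul hud hζd]
    rw [Finset.mul_sum, Finset.mul_sum, ← Finset.sum_add_distrib]
    exact Finset.sum_congr rfl fun j _ => by ring
  have h1 : -(ζ x * (∑ j, pd j u x * (x j - y j)) * P) ≤ (S * W * ζ x ^ 2 + V) / 2 := by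
    have i1 : (∑ j, pd j u x * (x j - y j)) ^ 2 ≤ S * q :=
      (Finset.sum_mul_sq_le_sq_mul_sq _ _ _).trans
        (mul_le_mul_of_nonneg_left (by rw [hqdef, radSq]; linarith) hS0)
    have i2 : (ζ x * (∑ j, pd j u x * (x j - y j)) * P) ^ 2 ≤ S * W * ζ x ^ 2 * V := by
      calc _ = (∑ j, pd j u x * (x j - y j)) ^ 2 * (ζ x ^ 2 * P ^ 2) := by ring
        _ ≤ S * q * (ζ x ^ 2 * P ^ 2) := by gcongr
        _ = S * ζ x ^ 2 * (P ^ 2 * q) := by ring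
        _ = _ := by rw [hPq]; ring
    refine neg_le_of_neg_le (abs_le_of_sq_le_sq' (i2.trans ?_) (by positivity)).1
    nlinarith [sq_nonneg (S * W * ζ x ^ 2 - V)]
  have h2 : -(u x * (∑ j, pd j ζ x * (x j - y j)) * P) ≤
      c * (R + D) / 2 * σ ^ (-(n / 2 : ℝ)) * χ ^ 2 := by
    have hR0 : 0 ≤ R := (Finset.sum_nonneg fun _ _ => sq_nonneg _).trans hR
    have hD0 : 0 ≤ D := (Finset.sum_nonneg fun _ _ => sq_nonneg _).trans hD
    rcases hζ with hζ | ⟨hχ, huc, hσq⟩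
    · have : 0 ≤ c * (R + D) / 2 * σ ^ (-(n / 2 : ℝ)) * χ ^ 2 := by positivity
      simpa [hζ] using this
    · have i1 : |∑ j, pd j ζ x * (x j - y j)| ≤ (R + D) / 2 := by
        refine abs_le_of_sq_le_sq ((Finset.sum_mul_sq_le_sq_mul_sq _ _ _).trans ?_) (by positivity)
        have := mul_le_mul hD hR (Finset.sum_nonneg fun _ _ => sq_nonneg _) hD0
        nlinarith [sq_nonneg (R - D)]
      have i2 : P ≤ σ ^ (-(n / 2 : ℝ)) :=
        Real.rpow_le_rpow_of_nonpos hσ hσq (by simp; positivity)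
      refine (neg_le_abs _).trans ?_
      rw [abs_mul, abs_mul, abs_of_nonneg hP0, hχ]
      calc _ ≤ c * ((R + D) / 2) * σ ^ (-(n / 2 : ℝ)) := by gcongr
        _ = _ := by ring
  rw [e1]
  linarith

/-- A positive value of `u` is controlled by a weighted Dirichlet integral and by the size of `u`
on the set where the cutoff varies. -/
lemma value_le_of_weighted_dirichlet_le {u ζ χ : EuclideanSpace ℝ (Fin n) → ℝ}
    (hn : 1 ≤ n) (hu : ContDiff ℝ 1 u) (hζ : ContDiff ℝ 1 ζ) (hζc : HasCompactSupport ζ)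
    (huζ : ∀ x, 0 ≤ u x * ζ x) (hχ : Continuous χ) (hχc : HasCompactSupport χ)
    (hζχ : ∀ x, (∀ k, pd k ζ x = 0) ∨ χ x = 1) {y : EuclideanSpace ℝ (Fin n)} (hζy : ζ y = 1)
    (huy : 0 < u y) {σ r D b c E I : ℝ} (hσ : 0 < σ) (hc : 0 ≤ c)
    (hD : ∀ x, ∑ k, pd k ζ x ^ 2 ≤ D) (hχu : ∀ x, χ x = 1 → |u x| ≤ c)
    (hχσ : ∀ x, χ x = 1 → σ ≤ ‖x - y‖ ^ 2) (hr : tsupport ζ ⊆ Metric.ball y r)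
    (hE : ∀ κ : ℝ, 0 < κ → κ ≤ 1 →
      ∫ x, (∑ k, pd k u x ^ 2) * radSq y κ x ^ (-b) * ζ x ^ 2 ≤ E)
    (hI : ∀ κ : ℝ, 0 < κ → ∫ x in Metric.ball y r, radSq y κ x ^ (1 - n + b) ≤ I) :
    u y * (n * 2 ^ (-(n / 2 : ℝ) - 2) *
        volume.real (Metric.ball (0 : EuclideanSpace ℝ (Fin n)) 1)) ≤
      E / 2 + I / 2 + c * (r ^ 2 + D) / 2 * σ ^ (-(n / 2 : ℝ)) * ∫ x, χ x ^ 2 := by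
  have : Nonempty (Fin n) := ⟨⟨0, hn⟩⟩
  set v : EuclideanSpace ℝ (Fin n) → ℝ := fun x => u x * ζ x with hv
  have hvC : ContDiff ℝ 1 v := hu.mul hζ
  have hvc : HasCompactSupport v := hζc.mul_left
  obtain ⟨ρ, hρ0, hρ1, hρ⟩ : ∃ ρ : ℝ, 0 < ρ ∧ ρ ≤ 1 ∧ ∀ x ∈ Metric.ball y ρ, u y / 2 ≤ v x := by
    have h1 : ∀ᶠ x in nhds y, u y / 2 < v x :=
      hvC.continuous.continuousAt.eventually_const_lt (by simp only [hv, hζy]; linarith)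
    obtain ⟨ρ, hρ0, hρ⟩ := Metric.eventually_nhds_iff_ball.1 h1
    exact ⟨min ρ 1, by positivity, min_le_right _ _,
      fun x hx => (hρ x (Metric.ball_subset_ball (min_le_left _ _) hx)).le⟩
  set κ := ρ ^ 2 with hκdef
  have hκ : 0 < κ := by positivity
  have hκ1 : κ ≤ 1 := by rw [hκdef]; nlinarith
  have hq : ∀ x, 0 < radSq y κ x := radSq_pos y hκ
  have hWc : ∀ p : ℝ, Continuous (fun x => radSq y κ x ^ p) := fun p =>
    (contDiff_radSq_rpow (k := 1) y hκ p).continuous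
  have hupc : ∀ j, Continuous (pd j u) := fun j => hu.continuous_pd
  have hvpc : ∀ j, Continuous (pd j v) := fun j => hvC.continuous_pd
  have hζcont := hζ.continuous
  have hvcont := hvC.continuous
  have hζ0 : ∀ x ∉ tsupport ζ, ζ x = 0 := fun x hx => image_eq_zero_of_notMem_tsupport hx
  have hv0 : ∀ x ∉ tsupport v, v x = 0 := fun x hx => image_eq_zero_of_notMem_tsupport hx
  have hpv0 : ∀ j, ∀ x ∉ tsupport v, pd j v x = 0 := fun j x hx =>
    pd_eq_zero_of_notMem_tsupport hx
  have hvζ : tsupport v ⊆ tsupport ζ := tsupport_mul_subset_right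
  have hD0 : 0 ≤ D := (Finset.sum_nonneg fun k _ => sq_nonneg (pd k ζ 0)).trans (hD 0)
  have i1 : Integrable fun x => v x * (n * κ * radSq y κ x ^ (-(n / 2 : ℝ) - 1)) :=
    integrable_of_eq_zero_off_tsupport (by fun_prop) hvc fun x hx => by simp [hv0 x hx]
  have i2 : Integrable fun x =>
      -((∑ j, pd j v x * (x j - y j)) * radSq y κ x ^ (-(n / 2 : ℝ))) :=
    integrable_of_eq_zero_off_tsupport (by fun_prop) hvc fun x hx => by simp [hpv0 _ x hx]
  have i3 : Integrable fun x => (∑ k, pd k u x ^ 2) * radSq y κ x ^ (-b) * ζ x ^ 2 :=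
    integrable_of_eq_zero_off_tsupport (by fun_prop) hζc fun x hx => by simp [hζ0 x hx]
  have i4 : Integrable ((Metric.ball y r).indicator fun x => radSq y κ x ^ (1 - n + b)) := by
    rw [integrable_indicator_iff Metric.isOpen_ball.measurableSet]
    exact ((hWc _).continuousOn.integrableOn_compact (isCompact_closedBall y r)).mono_set
      Metric.ball_subset_closedBall
  have i5 : Integrable fun x => χ x ^ 2 :=
    integrable_of_eq_zero_off_tsupport (by fun_prop) hχc fun x hx => by
      simp [image_eq_zero_of_notMem_tsupport hx]
  have hupper : ∀ x, -((∑ j, pd j v x * (x j - y j)) * radSq y κ x ^ (-(n / 2 : ℝ))) ≤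
      1 / 2 * ((∑ k, pd k u x ^ 2) * radSq y κ x ^ (-b) * ζ x ^ 2) +
        1 / 2 * (Metric.ball y r).indicator (fun x => radSq y κ x ^ (1 - n + b)) x +
        c * (r ^ 2 + D) / 2 * σ ^ (-(n / 2 : ℝ)) * χ x ^ 2 := by
    intro x
    by_cases hx : x ∈ tsupport ζ
    · have hxr := hr hx
      rw [Set.indicator_of_mem hxr]
      refine neg_sum_mul_rpow_le hκ hσ (hu.differentiable (by norm_num) x)
        (hζ.differentiable (by norm_num) x) ((hζχ x).imp_right fun h => ⟨h, hχu x h, ?_⟩) ?_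
        (hD x) hc
      · rw [radSq_eq]; linarith [hχσ x h]
      · have h1 := radSq_eq y 0 x
        rw [radSq, add_zero, add_zero] at h1
        rw [h1]
        rw [Metric.mem_ball, dist_eq_norm] at hxr
        gcongr
    · have h1 : 0 ≤ (Metric.ball y r).indicator (fun x => radSq y κ x ^ (1 - n + b)) x :=
        Set.indicator_nonneg (fun x _ => Real.rpow_nonneg (hq x).le _) x
      have h2 : 0 ≤ c * (r ^ 2 + D) / 2 * σ ^ (-(n / 2 : ℝ)) * χ x ^ 2 := by positivity
      simp only [hpv0 _ x fun h => hx (hvζ h), hζ0 x hx]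
      simp only [zero_mul, Finset.sum_const_zero, neg_zero, ne_eq, OfNat.ofNat_ne_zero,
        not_false_eq_true, zero_pow, mul_zero, zero_add]
      linarith
  have hlower : ∀ x, (Metric.ball y ρ).indicator
      (fun _ => u y / 2 * (n * κ * (2 * κ) ^ (-(n / 2 : ℝ) - 1))) x ≤
      v x * (n * κ * radSq y κ x ^ (-(n / 2 : ℝ) - 1)) := by
    intro x
    by_cases hx : x ∈ Metric.ball y ρ
    · rw [Set.indicator_of_mem hx]
      have h1 : radSq y κ x ≤ 2 * κ := by
        rw [radSq_eq, two_mul, hκdef]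
        rw [Metric.mem_ball, dist_eq_norm] at hx
        gcongr
      have h2 : (2 * κ) ^ (-(n / 2 : ℝ) - 1) ≤ radSq y κ x ^ (-(n / 2 : ℝ) - 1) :=
        Real.rpow_le_rpow_of_nonpos (hq x) h1 (by
          have : (0:ℝ) ≤ n / 2 := by positivity
          linarith)
      have := hρ x hx
      have : 0 ≤ v x := huζ x
      gcongr
    · rw [Set.indicator_of_notMem hx]
      exact mul_nonneg (huζ x) (mul_nonneg (by positivity) (Real.rpow_nonneg (hq x).le _))
  have hL := integral_mono
    ((integrable_indicator_iff Metric.isOpen_ball.measurableSet).2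
      (integrableOn_const (by finiteness))) i1 hlower
  rw [integral_indicator Metric.isOpen_ball.measurableSet, setIntegral_const, smul_eq_mul,
    integral_mul_radSq_rpow hvC hvc y hκ, ← integral_neg] at hL
  have j1 : Integrable fun x => 1 / 2 * ((∑ k, pd k u x ^ 2) * radSq y κ x ^ (-b) * ζ x ^ 2) +
        1 / 2 * (Metric.ball y r).indicator (fun x => radSq y κ x ^ (1 - n + b)) x :=
    (i3.const_mul _).add (i4.const_mul _)
  have hU := integral_mono i2 (j1.add (i5.const_mul _)) hupper
  simp only [Pi.add_apply] at hU
  rw [integral_add j1 (i5.const_mul _), integral_add (i3.const_mul _) (i4.const_mul _),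
    integral_const_mul, integral_const_mul, integral_const_mul,
    integral_indicator Metric.isOpen_ball.measurableSet] at hU
  have hvol : volume.real (Metric.ball y ρ) =
      ρ ^ n * volume.real (Metric.ball (0 : EuclideanSpace ℝ (Fin n)) 1) := by
    rw [measureReal_def, Measure.addHaar_ball_of_pos volume y hρ0, ENNReal.toReal_mul,
      ENNReal.toReal_ofReal (by positivity), finrank_euclideanSpace_fin, measureReal_def]
  have hpow : ρ ^ n * (κ * (2 * κ) ^ (-(n / 2 : ℝ) - 1)) = 2 ^ (-(n / 2 : ℝ) - 1) := by
    have e1 : κ * κ ^ (-(n / 2 : ℝ) - 1) = κ ^ (-(n / 2 : ℝ)) := by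
      rw [mul_comm, ← Real.rpow_add_one hκ.ne']; congr 1; ring
    have e2 : κ ^ (-(n / 2 : ℝ)) = (ρ ^ n)⁻¹ := by
      rw [hκdef, ← Real.rpow_natCast, ← Real.rpow_mul hρ0.le, ← Real.rpow_natCast,
        ← Real.rpow_neg hρ0.le]
      congr 1; push_cast; ring
    rw [Real.mul_rpow (by norm_num) hκ.le]
    calc _ = ρ ^ n * 2 ^ (-(n / 2 : ℝ) - 1) * (κ * κ ^ (-(n / 2 : ℝ) - 1)) := by ring
      _ = _ := by
        rw [e1, e2]
        have : ρ ^ n ≠ 0 := by positivity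
        field_simp
  have htwo : (2 : ℝ) ^ (-(n / 2 : ℝ) - 1) = 2 * 2 ^ (-(n / 2 : ℝ) - 2) := by
    rw [mul_comm, ← Real.rpow_add_one (by norm_num)]; congr 1; ring
  have hfin : volume.real (Metric.ball y ρ) * (u y / 2 * (n * κ * (2 * κ) ^ (-(n / 2 : ℝ) - 1))) =
      u y * (n * 2 ^ (-(n / 2 : ℝ) - 2) *
        volume.real (Metric.ball (0 : EuclideanSpace ℝ (Fin n)) 1)) := by
    rw [hvol]
    calc _ = u y / 2 * n * volume.real (Metric.ball (0 : EuclideanSpace ℝ (Fin n)) 1) *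
          (ρ ^ n * (κ * (2 * κ) ^ (-(n / 2 : ℝ) - 1))) := by ring
      _ = _ := by rw [hpow, htwo]; ring
  rw [hfin] at hL
  have := hE κ hκ hκ1
  have := hI κ hκ
  linarith

end ValueBound

section InteriorEstimate

variable {n : ℕ}

lemma exists_contDiff_cutoff {K V : Set (EuclideanSpace ℝ (Fin n))} (hK : IsCompact K)
    (hV : IsOpen V) (hKV : K ⊆ V) : ∃ ζ : EuclideanSpace ℝ (Fin n) → ℝ,
      ContDiff ℝ 2 ζ ∧ HasCompactSupport ζ ∧ tsupport ζ ⊆ V ∧ (∀ x, 0 ≤ ζ x) ∧ (∀ x, ζ x ≤ 1) ∧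
        ∀ x ∈ K, ∀ᶠ z in nhds x, ζ z = 1 := by
  obtain ⟨L, hL, hKL, hLV⟩ := exists_compact_between hK hV hKV
  obtain ⟨ζ, h1, h0, h01⟩ := exists_contMDiffMap_one_nhds_of_subset_interior
    (modelWithCornersSelf ℝ (EuclideanSpace ℝ (Fin n))) (n := 2) hK.isClosed hKL
  have hsupp : tsupport ζ ⊆ L :=
    closure_minimal (fun x hx => by_contra fun h => hx (h0 x h)) hL.isClosed
  exact ⟨ζ, ζ.contMDiff.contDiff, hL.of_isClosed_subset (isClosed_tsupport _) hsupp,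
    hsupp.trans hLV, fun x => (h01 x).1, fun x => (h01 x).2,
    fun x hx => mem_nhdsSet_iff_forall.1 h1 x hx⟩

lemma isCompact_le_infDist_frontier {Ω : Set (EuclideanSpace ℝ (Fin n))} (hΩ : IsOpen Ω)
    (hΩb : Bornology.IsBounded Ω) {t : ℝ} (ht : 0 < t) :
    IsCompact {x ∈ Ω | t ≤ Metric.infDist x (frontier Ω)} := by
  have h : {x ∈ Ω | t ≤ Metric.infDist x (frontier Ω)} =
      closure Ω ∩ {x | t ≤ Metric.infDist x (frontier Ω)} := by
    ext x
    refine ⟨fun hx => ⟨subset_closure hx.1, hx.2⟩, fun hx => ⟨by_contra fun hxΩ => ?_, hx.2⟩⟩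
    have h1 : x ∈ frontier Ω := by rw [hΩ.frontier_eq]; exact ⟨hx.1, hxΩ⟩
    have h2 : t ≤ Metric.infDist x (frontier Ω) := hx.2
    rw [Metric.infDist_zero_of_mem h1] at h2
    linarith
  rw [h]
  exact hΩb.isCompact_closure.inter_right
    (isClosed_le continuous_const (Metric.continuous_infDist_pt _))

lemma isOpen_lt_infDist_frontier {Ω : Set (EuclideanSpace ℝ (Fin n))} (hΩ : IsOpen Ω) (t : ℝ) :
    IsOpen {x ∈ Ω | t < Metric.infDist x (frontier Ω)} :=
  hΩ.inter (isOpen_lt continuous_const (Metric.continuous_infDist_pt _))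

lemma norm_gradient_sq (g : EuclideanSpace ℝ (Fin n) → ℝ) (x : EuclideanSpace ℝ (Fin n)) :
    ‖gradient g x‖ ^ 2 = ∑ i, pd i g x ^ 2 := by
  rw [EuclideanSpace.norm_sq_eq]
  refine Finset.sum_congr rfl fun i _ => ?_
  have h : gradient g x i = pd i g x := by
    have := InnerProductSpace.toDual_symm_apply (𝕜 := ℝ) (x := EuclideanSpace.single i (1 : ℝ))
      (y := fderiv ℝ g x)
    rw [pd, ← this, EuclideanSpace.inner_single_right]
    simp [gradient]
  rw [h, Real.norm_eq_abs, sq_abs]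

/-- Semi-stability tested with compactly supported `C¹` functions. -/
lemma IsSemiStable.integral_le {Ω O : Set (EuclideanSpace ℝ (Fin n))} {f : ℝ → ℝ}
    {u v ξ : EuclideanSpace ℝ (Fin n) → ℝ} (hs : IsSemiStable Ω f u) (hf : ContDiff ℝ 1 f)
    (hΩ : IsOpen Ω) (hO : O ⊆ Ω) (hv : Continuous v) (huv : ∀ x ∈ O, v x = u x)
    (hξ : ContDiff ℝ 1 ξ) (hξc : HasCompactSupport ξ) (hξO : tsupport ξ ⊆ O) :
    ∫ x, deriv f (v x) * ξ x ^ 2 ≤ ∫ x, ∑ i, pd i ξ x ^ 2 := by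
  have hξ0 : ∀ x ∉ tsupport ξ, ξ x = 0 := fun x hx => image_eq_zero_of_notMem_tsupport hx
  have hpξ0 : ∀ j, ∀ x ∉ tsupport ξ, pd j ξ x = 0 := fun j x hx =>
    pd_eq_zero_of_notMem_tsupport hx
  have h := hs ξ (hξ.lipschitzWith_of_hasCompactSupport hξc (by norm_num)) fun x hx => by
    refine hξ0 x fun h => ?_
    rw [hΩ.frontier_eq] at hx
    exact hx.2 (hO (hξO h))
  have hξpc : ∀ k, Continuous (pd k ξ) := fun k => hξ.continuous_pd
  have hf' : Continuous fun x => deriv f (v x) := (hf.continuous_deriv le_rfl).comp hv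
  have hξcont := hξ.continuous
  have e : ∀ x, ‖gradient ξ x‖ ^ 2 - deriv f (u x) * ξ x ^ 2 =
      ∑ i, pd i ξ x ^ 2 - deriv f (v x) * ξ x ^ 2 := fun x => by
    rw [norm_gradient_sq]
    by_cases hx : x ∈ tsupport ξ
    · rw [huv x (hξO hx)]
    · simp [hξ0 x hx]
  simp_rw [e] at h
  rw [setIntegral_eq_integral_of_forall_compl_eq_zero, integral_sub] at h
  · linarith
  · exact integrable_of_eq_zero_off_tsupport (by fun_prop) hξc fun x hx => by simp [hpξ0 _ x hx]
  · exact integrable_of_eq_zero_off_tsupport (by fun_prop) hξc fun x hx => by simp [hξ0 x hx]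
  · intro x hx
    have : x ∉ tsupport ξ := fun h => hx (hO (hξO h))
    simp [hξ0 x this, hpξ0 _ x this]

/-- Exponents for which the weighted estimate closes; this is where `n ≤ 4` enters. -/
lemma exists_weight_exponents {n : ℕ} (hn : n ∈ ({2, 3, 4} : Set ℕ)) {R : ℝ} (hR : 0 < R) :
    ∃ b α s L : ℝ, 0 ≤ b ∧ 0 ≤ α ∧ 0 < s ∧ 0 ≤ L ∧ 1 - n + b ≤ 0 ∧ -(n : ℝ) < 2 * (1 - n + b) ∧
      (α = 0 ∨ b = 2 * α + 1) ∧
      1 / 4 ≤ n - 1 - 2 * b - 4 * s * α ^ 2 - n * L / s ∧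
      ∀ q : ℝ, 0 < q → q ≤ R → q ^ (-b) * q ≤ L * (q ^ (-α)) ^ 2 := by
  by_cases h4 : n = 4
  · subst h4
    refine ⟨21 / 20, 1 / 40, 8, 1, by norm_num, by norm_num, by norm_num, by norm_num,
      by norm_num, by norm_num, by norm_num, by norm_num, fun q hq _ => le_of_eq ?_⟩
    rw [one_mul, ← Real.rpow_add_one hq.ne', ← Real.rpow_natCast, ← Real.rpow_mul hq.le]
    norm_num
  · have h2 : (2 : ℝ) ≤ n := by
      rcases hn with rfl | rfl | rfl <;> norm_num
    have h3 : (n : ℝ) ≤ 3 := by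
      rcases hn with rfl | rfl | rfl
      · norm_num
      · norm_num
      · exact absurd rfl h4
    have hL : 0 < R ^ (1 - (n / 2 - 3 / 4 : ℝ)) := by positivity
    refine ⟨n / 2 - 3 / 4, 0, 4 * n * R ^ (1 - (n / 2 - 3 / 4 : ℝ)),
      R ^ (1 - (n / 2 - 3 / 4 : ℝ)), by linarith, le_rfl, by positivity, hL.le, by linarith,
      by linarith, Or.inl rfl, ?_, fun q hq hqR => ?_⟩
    · have : n * R ^ (1 - (n / 2 - 3 / 4 : ℝ)) / (4 * n * R ^ (1 - (n / 2 - 3 / 4 : ℝ))) =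
          (1 / 4 : ℝ) := by
        field_simp
      rw [this]
      linarith
    · rw [← Real.rpow_add_one hq.ne', neg_zero, Real.rpow_zero, one_pow, mul_one, neg_add_eq_sub]
      exact Real.rpow_le_rpow hq.le hqR (by linarith)

/-- Away from the boundary a classical solution agrees with a compactly supported `C²` function. -/
lemma IsClassicalSol.exists_contDiff_eqOn {Ω O : Set (EuclideanSpace ℝ (Fin n))} {f : ℝ → ℝ}
    {u θ : EuclideanSpace ℝ (Fin n) → ℝ} (hu : IsClassicalSol Ω f u) (hO : IsOpen O)
    (hOΩ : O ⊆ Ω) (hθ : ContDiff ℝ 2 θ) (hθc : HasCompactSupport θ) (hθΩ : tsupport θ ⊆ Ω)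
    (hθO : ∀ x ∈ O, θ x = 1) :
    ∃ v : EuclideanSpace ℝ (Fin n) → ℝ, ContDiff ℝ 2 v ∧ HasCompactSupport v ∧
      (∀ x ∈ O, v x = u x) ∧ ∀ x ∈ O, ∑ j, pd j (pd j v) x + f (v x) = 0 := by
  obtain ⟨⟨U, hU, hΩU, huU⟩, heq, -⟩ := hu
  have hvu : ∀ x ∈ O, u x * θ x = u x := fun x hx => by rw [hθO x hx, mul_one]
  refine ⟨fun x => u x * θ x, contDiff_iff_contDiffAt.2 fun x => ?_, hθc.mul_left, hvu,
    fun x hx => ?_⟩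
  · by_cases hx : x ∈ tsupport θ
    · exact (huU.contDiffAt (hU.mem_nhds (hΩU (subset_closure (hθΩ hx))))).mul hθ.contDiffAt
    · refine (contDiffAt_const (c := (0 : ℝ))).congr_of_eventuallyEq ?_
      filter_upwards [notMem_tsupport_iff_eventuallyEq.1 hx] with z hz
      simp [hz]
  · have h1 : (fun x => u x * θ x) =ᶠ[nhds x] u := by
      filter_upwards [hO.mem_nhds hx] with z hz using hvu z hz
    have h2 : ∀ j, pd j (fun x => u x * θ x) =ᶠ[nhds x] pd j u := fun j => by
      filter_upwards [h1.eventuallyEq_nhds] with z hz using pd_congr_of_eventuallyEq hz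
    simp_rw [fun j => pd_congr_of_eventuallyEq (i := j) (h2 j), hvu x hx]
    exact heq x (hOΩ hx)

end InteriorEstimate

/-- (Proposition: interior estimate from a boundary estimate.)
For `2 ≤ n ≤ 4`, semi-stable solutions bounded near the boundary and bounded
below by a multiple of the distance to the boundary are uniformly bounded. -/
theorem interior_estimate_from_boundary
    (n : ℕ) (hn : n ∈ ({2, 3, 4} : Set ℕ))
    (Ω : Set (EuclideanSpace ℝ (Fin n))) (hΩ : IsSmoothBoundedDomain Ω)
    (ε c₃ c₄ M : ℝ) (hε : 0 < ε) (hc₃ : 0 < c₃) (hc₄ : 0 < c₄) (hM : 0 ≤ M) :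
    ∃ C : ℝ, 0 < C ∧
      ∀ f : ℝ → ℝ, ContDiff ℝ (⊤ : ℕ∞) f → (∀ s ∈ Set.Icc (0 : ℝ) c₄, |f s| ≤ M) →
      ∀ u : EuclideanSpace ℝ (Fin n) → ℝ,
        IsClassicalSol Ω f u → IsSemiStable Ω f u →
        (∀ x ∈ Ω, c₃ * Metric.infDist x (frontier Ω) ≤ u x) →
        (∀ x ∈ Ω, Metric.infDist x (frontier Ω) < ε → u x ≤ c₄) →
        ∀ x ∈ Ω, u x ≤ C := by
  obtain ⟨hΩo, hΩb, -, -⟩ := hΩ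
  have hn1 : 1 ≤ n := by rcases hn with rfl | rfl | rfl <;> norm_num
  have : Nonempty (Fin n) := ⟨⟨0, hn1⟩⟩
  set d : EuclideanSpace ℝ (Fin n) → ℝ := fun x => Metric.infDist x (frontier Ω) with hd
  have hdc : Continuous d := Metric.continuous_infDist_pt _
  have hK : ∀ t : ℝ, 0 < t → IsCompact {x ∈ Ω | t ≤ d x} := fun t ht =>
    isCompact_le_infDist_frontier hΩo hΩb ht
  have hV : ∀ t : ℝ, IsOpen {x ∈ Ω | t < d x} := isOpen_lt_infDist_frontier hΩo
  obtain ⟨ζ, hζ, hζc, hζV, hζ0, hζ1, hζK⟩ := exists_contDiff_cutoff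
    (hK (3 * ε / 8) (by positivity)) (hV (ε / 4)) fun x hx => ⟨hx.1, by linarith [hx.2]⟩
  obtain ⟨χ, hχ, hχc, hχV, -, -, hχK⟩ := exists_contDiff_cutoff
    ((hK (ε / 4) (by positivity)).inter_right (isClosed_le hdc (continuous_const (y := ε / 2))))
    ((hV (ε / 8)).inter (isOpen_lt hdc (continuous_const (y := 3 * ε / 4)))) fun x hx =>
      ⟨⟨hx.1.1, by linarith [hx.1.2]⟩, by
        have : d x ≤ ε / 2 := hx.2
        show d x < 3 * ε / 4
        linarith⟩
  obtain ⟨θ, hθ, hθc, hθΩ, -, -, hθK⟩ := exists_contDiff_cutoff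
    (hK (ε / 16) (by positivity)) hΩo fun x hx => hx.1
  set O := {x ∈ Ω | ε / 16 < d x} with hO
  have hζ1C : ContDiff ℝ 1 ζ := hζ.of_le (by norm_num)
  have hχ1C : ContDiff ℝ 1 χ := hχ.of_le (by norm_num)
  have hζO : tsupport ζ ⊆ O := fun x hx => ⟨(hζV hx).1, by linarith [(hζV hx).2]⟩
  have hχO : tsupport χ ⊆ O := fun x hx => ⟨(hχV hx).1.1, by linarith [(hχV hx).1.2]⟩
  have hζχ : ∀ x, (∀ k, pd k ζ x = 0) ∨ χ x = 1 := by
    intro x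
    by_cases hx : x ∈ tsupport ζ
    · rcases le_total (3 * ε / 8) (d x) with h | h
      · refine Or.inl fun k => ?_
        rw [pd_congr_of_eventuallyEq (h := fun _ => 1) (hζK x ⟨(hζV hx).1, h⟩)]
        simp [pd]
      · refine Or.inr (hχK x ⟨⟨(hζV hx).1, (hζV hx).2.le⟩, ?_⟩).self_of_nhds
        show d x ≤ ε / 2
        linarith
    · exact Or.inl fun k => pd_eq_zero_of_notMem_tsupport hx
  obtain ⟨D, hD⟩ : ∃ D, ∀ x, ∑ k, pd k ζ x ^ 2 ≤ D := by
    have hζpc : ∀ k, Continuous (pd k ζ) := fun k => hζ1C.continuous_pd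
    obtain ⟨D, hD⟩ := (by fun_prop : Continuous fun x => ∑ k, pd k ζ x ^ 2)
      |>.bounded_above_of_compact_support (HasCompactSupport.intro hζc fun x hx => by
        simp [pd_eq_zero_of_notMem_tsupport hx])
    exact ⟨D, fun x => (le_abs_self _).trans (hD x)⟩
  obtain ⟨r, hr0, hr⟩ : ∃ r : ℝ, 0 < r ∧ ∀ y ∈ Ω, Ω ⊆ Metric.ball y r := by
    obtain ⟨r, hr⟩ := Metric.isBounded_iff.1 hΩb
    exact ⟨|r| + 1, by positivity, fun y hy x hx => by
      rw [Metric.mem_ball]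
      linarith [hr hx hy, le_abs_self r]⟩
  obtain ⟨b, α, s, L, hb, hα0, hs, hL0, hp0, hp, hα, hpar, hL⟩ :=
    exists_weight_exponents hn (R := r ^ 2 + 1) (by positivity)
  obtain ⟨I, hI⟩ := exists_setIntegral_radSq_rpow_le hn1 hp0 hp r
  set σ := (ε / 4) ^ 2 with hσ
  have hσ0 : 0 < σ := by positivity
  have hD0 : 0 ≤ D := (Finset.sum_nonneg fun k _ => sq_nonneg (pd k ζ 0)).trans (hD 0)
  set E := 4 * (2 * σ ^ (-b) * (r ^ 2 + D) + s * σ ^ (-(2 * α)) * D) *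
    ∫ x, (2 * M * c₄ * χ x ^ 2 + 4 * c₄ ^ 2 * ∑ k, pd k χ x ^ 2)
  set A := n * 2 ^ (-(n / 2 : ℝ) - 2) *
    volume.real (Metric.ball (0 : EuclideanSpace ℝ (Fin n)) 1) with hA
  have hA0 : 0 < A := by
    have : 0 < volume.real (Metric.ball (0 : EuclideanSpace ℝ (Fin n)) 1) :=
      ENNReal.toReal_pos (Metric.measure_ball_pos _ _ one_pos).ne' (by finiteness)
    positivity
  set B := E / 2 + I / 2 + c₄ * (r ^ 2 + D) / 2 * σ ^ (-(n / 2 : ℝ)) * ∫ x, χ x ^ 2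
  refine ⟨max c₄ (B / A), lt_max_of_lt_left hc₄, fun f hf hfM u hsol hst hlow hup y hy => ?_⟩
  rcases lt_or_ge (d y) ε with hyε | hyε
  · exact le_max_of_le_left (hup y hy hyε)
  have hf1 : ContDiff ℝ 1 f := hf.of_le (by exact_mod_cast le_top)
  have hOo : IsOpen O := hV _
  have hOΩ : O ⊆ Ω := fun x hx => hx.1
  obtain ⟨v, hv, hvc, hvu, hveq⟩ := hsol.exists_contDiff_eqOn hOo hOΩ hθ hθc hθΩ
    fun x hx => (hθK x ⟨hx.1, hx.2.le⟩).self_of_nhds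
  have hstab : ∀ ξ : EuclideanSpace ℝ (Fin n) → ℝ, ContDiff ℝ 1 ξ → HasCompactSupport ξ →
      tsupport ξ ⊆ O → ∫ x, deriv f (v x) * ξ x ^ 2 ≤ ∫ x, ∑ i, pd i ξ x ^ 2 :=
    fun ξ hξ hξc hξO => hst.integral_le hf1 hΩo hOΩ hv.continuous hvu hξ hξc hξO
  have hyO : y ∈ O := ⟨hy, by linarith⟩
  have hv0 : ∀ x ∈ O, 0 ≤ v x := fun x hx => by
    rw [hvu x hx]
    exact (mul_nonneg hc₃.le Metric.infDist_nonneg).trans (hlow x hx.1)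
  have hχd : ∀ x, χ x ≠ 0 → x ∈ O ∧ d x < 3 * ε / 4 := fun x hx =>
    ⟨hχO (subset_tsupport _ hx), (hχV (subset_tsupport _ hx)).2⟩
  have hvc₄ : ∀ x, χ x ≠ 0 → v x ≤ c₄ := fun x hx => by
    obtain ⟨hxO, hxd⟩ := hχd x hx
    rw [hvu x hxO]
    exact hup x hxO.1 (by show d x < ε; linarith)
  have hvabs : ∀ x, χ x ≠ 0 → |v x| ≤ c₄ := fun x hx => by
    rw [abs_of_nonneg (hv0 x (hχd x hx).1)]
    exact hvc₄ x hx
  have hχσ : ∀ x, χ x = 1 → σ ≤ ‖x - y‖ ^ 2 := fun x hx => by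
    have h1 := (hχd x (by simp [hx])).2
    have h2 : d y ≤ d x + dist y x := Metric.infDist_le_infDist_add_dist
    rw [dist_comm, dist_eq_norm] at h2
    rw [hσ]
    gcongr
    linarith
  have hζr : tsupport ζ ⊆ Metric.ball y r := fun x hx => hr y hy (hζO hx).1
  have hζR : ∀ x ∈ tsupport ζ, ∑ j, (x j - y j) ^ 2 ≤ r ^ 2 := fun x hx => by
    have h1 := radSq_eq y 0 x
    have h2 := hζr hx
    rw [Metric.mem_ball, dist_eq_norm] at h2
    rw [radSq, add_zero, add_zero] at h1
    rw [h1]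
    gcongr
  have hcacc := integral_gradSq_mul_sq_le hv hveq hχ1C hχc hχO hvabs fun x hx =>
    hfM _ ⟨hv0 x (hχd x hx).1, hvc₄ x hx⟩
  have hE : ∀ κ : ℝ, 0 < κ → κ ≤ 1 →
      ∫ x, (∑ k, pd k v x ^ 2) * radSq y κ x ^ (-b) * ζ x ^ 2 ≤ E := fun κ hκ hκ1 =>
    (weighted_dirichlet_le hv hvc hf1 hveq hstab hζ1C hζc hζO hζ0 hζ1 hχ.continuous hχc hζχ
      hD hκ hσ0 (fun x hx => by rw [radSq_eq]; linarith [hχσ x hx]) (sq_nonneg r) hζR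
      hb hα0 hs hL0 (fun x hx => hL _ (radSq_pos y hκ x) (by rw [radSq]; linarith [hζR x hx]))
      hα hpar).trans (mul_le_mul_of_nonneg_left hcacc (by positivity))
  rcases le_or_gt (u y) 0 with huy | huy
  · exact le_max_of_le_left (huy.trans hc₄.le)
  · refine le_max_of_le_right ((le_div_iff₀ hA0).2 ?_)
    rw [← hvu y hyO] at huy ⊢
    refine value_le_of_weighted_dirichlet_le hn1 (hv.of_le (by norm_num)) hζ1C hζc (fun x => ?_)
      hχ.continuous hχc hζχ (hζK y ⟨hy, by linarith⟩).self_of_nhds huy hσ0 hc₄.le hD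
      (fun x hx => hvabs x (by simp [hx])) hχσ hζr hE (hI y)
    by_cases hx : x ∈ tsupport ζ
    · exact mul_nonneg (hv0 x (hζO hx)) (hζ0 x)
    · simp [image_eq_zero_of_notMem_tsupport hx]
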